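/- arXiv:2405.17948 — 4 statements merged into one kernel-verified Lean document; each statement's English description precedes it below -/
import Mathlib

section
/- Let C be a dendritic face complex. Then the relation <⁺ is irreflexive: there is no x ∈ C with x <⁺ x. Consequently <⁺ is a strict partial order on C. -/
/-- The signed codimension-1 face relation: `true` stands for `≺⁺`, `false` for `≺⁻`. -/
def sprec {α : Type*} (precN precP : α → α → Prop) : Bool → α → α → Prop
  | true => precP
  | false => precN

/-- A dendritic face complex (DFC) on a finite type `α` of faces: a positive-to-one
poset (graded by `dim`, with source relation `precN` = `≺⁻`, target relation
`precP` = `≺⁺`, and target map `tgt` = `γ`) together with a greatest element `top` = `ω`,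
oriented thinness (`thin`), and acyclicity (`src_singleton`, `src_exists`, `no_cycle`). -/
structure DFC (α : Type*) [Fintype α] where
  dim : α → ℕ
  precN : α → α → Prop
  precP : α → α → Prop
  tgt : α → α
  dim_precN : ∀ {y x}, precN y x → dim x = dim y + 1
  dim_precP : ∀ {y x}, precP y x → dim x = dim y + 1
  not_both : ∀ y x, ¬ (precN y x ∧ precP y x)
  tgt_precP : ∀ x, 1 ≤ dim x → precP (tgt x) x
  precP_unique : ∀ {y x}, precP y x → y = tgt x
  src_exists : ∀ x, 1 ≤ dim x → ∃ y, precN y x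
  top : α
  le_top : ∀ x, Relation.ReflTransGen (fun a b => precN a b ∨ precP a b) x top
  thin : ∀ (a b : Bool) (x y z : α), sprec precN precP b z y → sprec precN precP a y x →
    ∃! y', y' ≠ y ∧ ∃ a' b', sprec precN precP b' z y' ∧ sprec precN precP a' y' x ∧
      ((a = b) ↔ ¬ (a' = b'))
  src_singleton : ∀ x, dim x = 1 → ∃! y, precN y x
  no_cycle : ∀ (x : α) (p : ℕ), 1 ≤ p → ∀ y : ℕ → α,
    (∀ i, 1 ≤ i → i ≤ p → precN (y i) x) → y (p + 1) = y 1 →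
    ¬ (∀ i, 1 ≤ i → i ≤ p → precN (tgt (y (i + 1))) (y i))

namespace DFC

variable {α : Type*} [Fintype α]

/-- `x ◁ y` : there is `t` with `x ≺⁻ t` and `y ≺⁺ t`. -/
def tri (D : DFC α) (x y : α) : Prop := ∃ t, D.precN x t ∧ D.precP y t

/-- `<⁺` : the transitive closure of `◁`. -/
def ltP (D : DFC α) : α → α → Prop := Relation.TransGen D.tri

/-- The iterated target `γ^{(k)}ω ∈ C_k` (for `k ≤ n = dim ω`). -/
def itTgt (D : DFC α) (k : ℕ) : α := D.tgt^[D.dim D.top - k] D.top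

/-- Membership in `Λ_k` : a `k`-dimensional face that is the target of no face. -/
def lam (D : DFC α) (k : ℕ) (x : α) : Prop := D.dim x = k ∧ ∀ c, ¬ D.precP x c

/-- A (possibly trivial) lower path from `c` to `c'` inside `δ(b)`, all of whose
lower witnesses `dᵢ` have `e` as a `≺^β`-face: `c = c₀ ≻⁻ d₀ ≺⁺ c₁ ≻⁻ d₁ ≺⁺ ⋯ ≺⁺ c_p = c'`. -/
def lowerPath (D : DFC α) (β : Bool) (b e c c' : α) : Prop :=
  ∃ (p : ℕ) (cs ds : ℕ → α), cs 0 = c ∧ cs p = c' ∧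
    (∀ i ≤ p, D.precN (cs i) b) ∧
    ∀ i < p, D.precN (ds i) (cs i) ∧ D.precP (ds i) (cs (i + 1)) ∧
      sprec D.precN D.precP β e (ds i)

/-- A non-trivial simple `δ(b)`-zig-zag from `c` to `c'`: first `r` ascending steps
`cᵢ ≻⁺ dᵢ ≺⁻ c_{i+1}` with `e ≺^β dᵢ`, then `p − r` descending steps
`cᵢ ≻⁻ dᵢ ≺⁺ c_{i+1}` with `e ≺^{−β} dᵢ`, with pairwise distinct `dᵢ`. -/
def zigzag (D : DFC α) (β : Bool) (b e c c' : α) : Prop :=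
  ∃ (p r : ℕ), 1 ≤ p ∧ r ≤ p ∧ ∃ cs ds : ℕ → α,
    cs 0 = c ∧ cs p = c' ∧ (∀ i ≤ p, D.precN (cs i) b) ∧
    (∀ i j, i < p → j < p → i ≠ j → ds i ≠ ds j) ∧
    (∀ i < r, D.precP (ds i) (cs i) ∧ D.precN (ds i) (cs (i + 1)) ∧
      sprec D.precN D.precP β e (ds i)) ∧
    (∀ i, r ≤ i → i < p → D.precN (ds i) (cs i) ∧ D.precP (ds i) (cs (i + 1)) ∧
      sprec D.precN D.precP (!β) e (ds i))

end DFC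

namespace DFC

variable {α : Type*} [Fintype α]

def S (D : DFC α) (s : Bool) (y x : α) : Prop := sprec D.precN D.precP s y x

def le (D : DFC α) (x y : α) : Prop :=
  Relation.ReflTransGen (fun a b => D.precN a b ∨ D.precP a b) x y

def EdgeAt (D : DFC α) (d t c c' : α) : Prop :=
  (∃ s, D.precN c t ∧ D.precP c' t ∧ D.S s d c ∧ D.S s d c') ∨
  (∃ s, D.precP c t ∧ D.precN c' t ∧ D.S s d c ∧ D.S s d c') ∨
  (∃ s, D.precN c t ∧ D.precN c' t ∧ D.S s d c ∧ D.S (!s) d c')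

def Lam (D : DFC α) (t : α) : Prop := ∀ c, ¬ D.precP t c

def EdgeAny (D : DFC α) (d c c' : α) : Prop := ∃ t, D.EdgeAt d t c c'

def EdgeLam (D : DFC α) (d c c' : α) : Prop := ∃ t, D.Lam t ∧ D.EdgeAt d t c c'

def AcycAbove (D : DFC α) (m : ℕ) : Prop :=
  ∀ x, m < D.dim x → ¬ Relation.TransGen D.tri x x

def Uq (D : DFC α) (c : α) : Prop :=
  ∀ s t t', D.Lam t → D.Lam t' → D.S s c t → D.S s c t' → t = t'

lemma S_dim (D : DFC α) {s : Bool} {y x : α} (h : D.S s y x) : D.dim x = D.dim y + 1 := by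
  cases s
  · exact D.dim_precN h
  · exact D.dim_precP h

lemma S_sign (D : DFC α) {s s' : Bool} {y x : α} (h : D.S s y x) (h' : D.S s' y x) :
    s = s' := by
  cases s <;> cases s'
  · rfl
  · exact absurd ⟨h, h'⟩ (D.not_both y x)
  · exact absurd ⟨h', h⟩ (D.not_both y x)
  · rfl

lemma S_step (D : DFC α) {s : Bool} {y x : α} (h : D.S s y x) :
    D.precN y x ∨ D.precP y x := by
  cases s
  · exact Or.inl h
  · exact Or.inr h

lemma S_of_step (D : DFC α) {y x : α} (h : D.precN y x ∨ D.precP y x) :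
    ∃ s, D.S s y x := by
  rcases h with h | h
  · exact ⟨false, h⟩
  · exact ⟨true, h⟩

lemma partner_unique (D : DFC α) {a b a1 b1 a2 b2 : Bool} {x y z y1 y2 : α}
    (h1 : D.S b z y) (h2 : D.S a y x) (h3 : D.S b1 z y1) (h4 : D.S a1 y1 x)
    (h5 : D.S b2 z y2) (h6 : D.S a2 y2 x) (e1 : (a = b) ↔ ¬ (a1 = b1))
    (e2 : (a = b) ↔ ¬ (a2 = b2)) : y1 = y2 := by
  have key : ∀ {y' a' b'}, D.S b' z y' → D.S a' y' x → ((a = b) ↔ ¬ (a' = b')) → y' ≠ y := by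
    intro y' a' b' g1 g2 g3 h
    subst h
    have := D.S_sign h1 g1
    have := D.S_sign h2 g2
    subst_vars
    tauto
  obtain ⟨w, _, hw⟩ := D.thin a b x y z h1 h2
  exact (hw y1 ⟨key h3 h4 e1, a1, b1, h3, h4, e1⟩).trans
    (hw y2 ⟨key h5 h6 e2, a2, b2, h5, h6, e2⟩).symm

lemma T1 (D : DFC α) {s : Bool} {d c t : α} (h1 : D.S s d c) (h2 : D.precN c t) :
    (∃ g, D.precP g t ∧ D.S s d g) ∨ ∃ c1, D.precN c1 t ∧ D.S (!s) d c1 := by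
  obtain ⟨y, ⟨_, a', b', h3, h4, h5⟩, _⟩ := D.thin false s t c d h1 h2
  cases a'
  · right
    have e : b' = !s := by revert h5; cases s <;> cases b' <;> simp
    exact ⟨y, h4, e ▸ h3⟩
  · left
    have e : b' = s := by revert h5; cases s <;> cases b' <;> simp
    exact ⟨y, h4, e ▸ h3⟩

lemma T2 (D : DFC α) {s : Bool} {d c t : α} (h1 : D.S s d c) (h2 : D.precP c t) :
    ∃ c1, D.precN c1 t ∧ D.S s d c1 := by
  obtain ⟨y, ⟨hne, a', b', h3, h4, h5⟩, _⟩ := D.thin true s t c d h1 h2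
  cases a'
  · refine ⟨y, h4, ?_⟩
    cases s <;> cases b' <;> simp_all [S]
  · exact absurd ((D.precP_unique h4).trans (D.precP_unique h2).symm) hne

lemma P_eq (D : DFC α) {y y' x : α} (h : D.precP y x) (h' : D.precP y' x) : y = y' :=
  (D.precP_unique h).trans (D.precP_unique h').symm

lemma dir_unique (D : DFC α) {s : Bool} {d g t c c1 : α} (h1 : D.S s d g) (h2 : D.precP g t)
    (h3 : D.S s d c) (h4 : D.precN c t) (h5 : D.S s d c1) (h6 : D.precN c1 t) : c = c1 :=
  D.partner_unique (a := true) (a1 := false) (a2 := false) h1 h2 h3 h4 h5 h6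
    (by cases s <;> simp) (by cases s <;> simp)

lemma mix_unique (D : DFC α) {s : Bool} {d g t c c1 : α} (h1 : D.S s d g) (h2 : D.precN g t)
    (h3 : D.S (!s) d c) (h4 : D.precN c t) (h5 : D.S (!s) d c1) (h6 : D.precN c1 t) : c = c1 :=
  D.partner_unique (a := false) (a1 := false) (a2 := false) h1 h2 h3 h4 h5 h6
    (by cases s <;> simp) (by cases s <;> simp)

lemma mix_dir (D : DFC α) {s : Bool} {d g t c c1 : α} (h1 : D.S s d c) (h2 : D.precN c t)
    (h3 : D.S s d g) (h4 : D.precP g t) (h5 : D.S (!s) d c1) (h6 : D.precN c1 t) : False := by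
  have : g = c1 := D.partner_unique (a := false) (a1 := true) (a2 := false) h1 h2 h3 h4 h5 h6
    (by cases s <;> simp) (by cases s <;> simp)
  subst this
  exact D.not_both _ _ ⟨h6, h4⟩

lemma two_cover (D : DFC α) {a b a' b' : Bool} {d c c' t : α} (hne : c ≠ c')
    (h1 : D.S b d c) (h2 : D.S a c t) (h3 : D.S b' d c') (h4 : D.S a' c' t) :
    (a = b) ↔ ¬ (a' = b') := by
  by_contra hcon
  obtain ⟨y, ⟨_, a1, b1, g1, g2, g3⟩, _⟩ := D.thin a b t c d h1 h2
  exact hne (D.partner_unique g1 g2 h1 h2 h3 h4 (by tauto) (by tauto))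

lemma edge_of_cover (D : DFC α) {b b' : Bool} {d c c' t : α} (hne : c ≠ c')
    (h1 : D.S b d c) (h2 : D.precN c t ∨ D.precP c t) (h3 : D.S b' d c')
    (h4 : D.precN c' t ∨ D.precP c' t) : D.EdgeAt d t c c' := by
  rcases h2 with h2 | h2 <;> rcases h4 with h4 | h4
  · have := D.two_cover (a := false) (a' := false) hne h1 h2 h3 h4
    refine Or.inr (Or.inr ⟨b, h2, h4, h1, ?_⟩)
    have e : b' = !b := by cases b <;> cases b' <;> simp_all
    rwa [← e]
  · have := D.two_cover (a := false) (a' := true) hne h1 h2 h3 h4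
    refine Or.inl ⟨b, h2, h4, h1, ?_⟩
    have e : b' = b := by cases b <;> cases b' <;> simp_all
    rwa [← e]
  · have := D.two_cover (a := true) (a' := false) hne h1 h2 h3 h4
    refine Or.inr (Or.inl ⟨b, h2, h4, h1, ?_⟩)
    have e : b' = b := by cases b <;> cases b' <;> simp_all
    rwa [← e]
  · exact absurd (D.P_eq h2 h4) hne

lemma tri_dim (D : DFC α) {x y : α} (h : D.tri x y) : D.dim x = D.dim y := by
  obtain ⟨t, h1, h2⟩ := h
  have := D.dim_precN h1
  have := D.dim_precP h2
  omega

lemma transGen_tri_dim (D : DFC α) {x y : α} (h : Relation.TransGen D.tri x y) :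
    D.dim x = D.dim y := by
  induction h with
  | single h => exact D.tri_dim h
  | tail _ h ih => exact ih.trans (D.tri_dim h)

lemma wf_tri (D : DFC α) {m : ℕ} (H : D.AcycAbove m) :
    WellFounded (fun x y : α => m < D.dim x ∧ Relation.TransGen D.tri x y) := by
  let r := fun x y : α => m < D.dim x ∧ Relation.TransGen D.tri x y
  have : IsTrans α r := ⟨fun a b c h1 h2 => ⟨h1.1, h1.2.trans h2.2⟩⟩
  have : Std.Irrefl r := ⟨fun a h => H a h.1 h.2⟩
  exact Finite.wellFounded_of_trans_of_irrefl r

lemma wf_tri_rev (D : DFC α) {m : ℕ} (H : D.AcycAbove m) :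
    WellFounded (fun x y : α => m < D.dim x ∧ Relation.TransGen D.tri y x) := by
  let r := fun x y : α => m < D.dim x ∧ Relation.TransGen D.tri y x
  have : IsTrans α r := ⟨fun a b c h1 h2 => ⟨h1.1, h2.2.trans h1.2⟩⟩
  have : Std.Irrefl r := ⟨fun a h => H a h.1 h.2⟩
  exact Finite.wellFounded_of_trans_of_irrefl r

lemma le_dim (D : DFC α) {x y : α} (h : D.le x y) : D.dim x ≤ D.dim y := by
  unfold le at h
  induction h with
  | refl => exact le_rfl
  | tail _ h ih =>
    rcases h with h | h
    · have := D.dim_precN h; omega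
    · have := D.dim_precP h; omega

lemma le_eq_of_dim (D : DFC α) {x y : α} (h : D.le x y) (hd : D.dim x = D.dim y) : x = y := by
  rcases Relation.ReflTransGen.cases_tail h with h | ⟨z, h1, h2⟩
  · exact h.symm
  · have := D.le_dim h1
    obtain ⟨s, hs⟩ := D.S_of_step h2
    have := D.S_dim hs
    omega

lemma le_coatom (D : DFC α) {x y : α} (h : D.le x y) (hd : D.dim x < D.dim y) :
    ∃ z s, D.le x z ∧ D.S s z y := by
  rcases Relation.ReflTransGen.cases_tail h with h | ⟨z, h1, h2⟩
  · subst h; omega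
  · obtain ⟨s, hs⟩ := D.S_of_step h2
    exact ⟨z, s, h1, hs⟩

lemma le_atom (D : DFC α) {x y : α} (h : D.le x y) (hd : D.dim x < D.dim y) :
    ∃ z s, D.S s x z ∧ D.le z y := by
  rcases Relation.ReflTransGen.cases_head h with h | ⟨z, h1, h2⟩
  · subst h; omega
  · obtain ⟨s, hs⟩ := D.S_of_step h1
    exact ⟨z, s, hs, h2⟩

lemma le_tail (D : DFC α) {s : Bool} {x y z : α} (h : D.le x y) (h' : D.S s y z) : D.le x z :=
  Relation.ReflTransGen.tail h (D.S_step h')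

lemma le_head (D : DFC α) {s : Bool} {x y z : α} (h' : D.S s x y) (h : D.le y z) : D.le x z :=
  Relation.ReflTransGen.head (D.S_step h') h

lemma conn_any (D : DFC α) (d : α) (H : D.AcycAbove (D.dim d)) (r : ℕ) :
    ∀ b, D.dim b = D.dim d + (r + 2) → ∀ c c' s s', D.S s d c → D.S s' d c' →
      D.le c b → D.le c' b → Relation.EqvGen (D.EdgeAny d) c c' := by
  induction r with
  | zero =>
    intro b hb c c' s s' hc hc' hcb hcb'
    by_cases hne : c = c'
    · subst hne; exact Relation.EqvGen.refl _
    have d1 := D.S_dim hc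
    have d2 := D.S_dim hc'
    obtain ⟨z, u, hz, hu⟩ := D.le_coatom hcb (by omega)
    obtain ⟨z', u', hz', hu'⟩ := D.le_coatom hcb' (by omega)
    have d3 := D.S_dim hu
    have d4 := D.S_dim hu'
    have := D.le_eq_of_dim hz (by omega)
    have := D.le_eq_of_dim hz' (by omega)
    subst_vars
    exact Relation.EqvGen.rel _ _ ⟨b, D.edge_of_cover hne hc (D.S_step hu) hc' (D.S_step hu')⟩
  | succ r ih =>
    intro b hb
    have hg : D.precP (D.tgt b) b := D.tgt_precP b (by omega)
    have hgd := D.dim_precP hg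
    have claim : ∀ y x, D.precP y x → D.precN x b → ∀ a s, D.S s d a → D.le a x →
        ∃ a' s', D.S s' d a' ∧ D.le a' (D.tgt b) ∧ Relation.EqvGen (D.EdgeAny d) a a' := by
      intro y
      induction y using (D.wf_tri H).induction with
      | _ y IH =>
      intro x hyx hxb a s ha hax
      have e1 := D.dim_precN hxb
      have hdx : D.le d x := D.le_head ha hax
      obtain ⟨y1, hy1, hdy1⟩ : ∃ y1, D.precN y1 x ∧ D.le d y1 := by
        obtain ⟨z, u, hz, hu⟩ := D.le_coatom hdx (by omega)
        cases u
        · exact ⟨z, hu, hz⟩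
        · have := D.S_dim hu
          obtain ⟨w, v, hw, hv⟩ := D.le_coatom hz (by omega)
          obtain ⟨c1, g1, g2⟩ := D.T2 hv hu
          exact ⟨c1, g1, D.le_tail hw g2⟩
      have e2 := D.dim_precN hy1
      obtain ⟨a1, s1, ha1, hay1⟩ := D.le_atom hdy1 (by omega)
      have hco : Relation.EqvGen (D.EdgeAny d) a a1 :=
        ih x (by omega) a a1 s s1 ha ha1 hax (D.le_tail (s := false) hay1 hy1)
      rcases D.T1 (s := false) hy1 hxb with ⟨g, g1, g2⟩ | ⟨x1, g1, g2⟩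
      · have := D.P_eq g1 hg
        subst this
        exact ⟨a1, s1, ha1, D.le_tail hay1 g2, hco⟩
      · obtain ⟨a2, s2, k1, k2, k3⟩ := IH y1 ⟨by omega, .single ⟨x, hy1, hyx⟩⟩ x1 g2 g1 a1 s1 ha1
          (D.le_tail hay1 g2)
        exact ⟨a2, s2, k1, k2, hco.trans _ _ _ k3⟩
    have claim2 : ∀ c s, D.S s d c → D.le c b →
        ∃ a' s', D.S s' d a' ∧ D.le a' (D.tgt b) ∧ Relation.EqvGen (D.EdgeAny d) c a' := by
      intro c s hc hcb
      have := D.S_dim hc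
      obtain ⟨z, u, hz, hu⟩ := D.le_coatom hcb (by omega)
      cases u
      · have := D.S_dim hu
        exact claim _ z (D.tgt_precP z (by omega)) hu c s hc hz
      · have := D.P_eq hu hg
        subst this
        exact ⟨c, s, hc, hz, .refl _⟩
    intro c c' s s' hc hc' hcb hcb'
    obtain ⟨a, u, h1, h2, h3⟩ := claim2 c s hc hcb
    obtain ⟨a', u', h1', h2', h3'⟩ := claim2 c' s' hc' hcb'
    exact h3.trans _ _ _ ((ih _ (by omega) a a' u u' h1 h1' h2 h2').trans _ _ _ (h3'.symm _ _))

lemma edge_lam (D : DFC α) (d : α) (H : D.AcycAbove (D.dim d)) :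
    ∀ t c c', D.EdgeAt d t c c' → Relation.EqvGen (D.EdgeLam d) c c' := by
  intro t
  induction t using (D.wf_tri H).induction with
  | _ t IH =>
  intro c c' he
  by_cases hl : D.Lam t
  · exact .rel _ _ ⟨t, hl, he⟩
  unfold Lam at hl
  push Not at hl
  obtain ⟨s, hts⟩ := hl
  have hdt : D.dim d + 2 = D.dim t := by
    rcases he with ⟨u, h1, _, h2, _⟩ | ⟨u, h1, _, h2, _⟩ | ⟨u, h1, _, h2, _⟩
    · have := D.dim_precN h1; have := D.S_dim h2; omega
    · have := D.dim_precP h1; have := D.S_dim h2; omega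
    · have := D.dim_precN h1; have := D.S_dim h2; omega
  have IH' : ∀ y, D.precN y s → ∀ c c', D.EdgeAt d y c c' →
      Relation.EqvGen (D.EdgeLam d) c c' := by
    intro y hy
    have hty : D.tri y t := ⟨s, hy, hts⟩
    exact IH y ⟨by have := D.tri_dim hty; omega, .single hty⟩
  have back : ∀ u c0, (∀ v, D.precN v t → D.S u d v → v = c0) →
      ∀ v, D.S u d v → ∀ y, D.precN v y → D.precN y s →
        Relation.EqvGen (D.EdgeLam d) v c0 := by
    intro u c0 huq v
    induction v using (D.wf_tri H).induction with
    | _ v IHv =>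
    intro hv y hvy hys
    rcases D.T1 (s := false) hvy hys with ⟨g, g1, g2⟩ | ⟨y1, g1, g2⟩
    · have := D.P_eq g1 hts
      subst this
      rw [huq v g2 hv]
      exact .refl _
    · obtain ⟨w, hw1, hw2⟩ := D.T2 hv g2
      have hwv : D.tri w v := ⟨y1, hw1, g2⟩
      have := IHv w ⟨by have := D.S_dim hw2; omega, .single hwv⟩ hw2 y1 hw1 g1
      exact .trans _ _ _ ((IH' y1 g1 w v (Or.inl ⟨u, hw1, g2, hw2, hv⟩)).symm _ _) this
  have dir : ∀ u c c', D.precN c t → D.precP c' t → D.S u d c → D.S u d c' →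
      Relation.EqvGen (D.EdgeLam d) c' c := by
    intro u c c' h1 h2 h3 h4
    obtain ⟨y, hy1, hy2⟩ := D.T2 (s := true) h2 hts
    obtain ⟨w, hw1, hw2⟩ := D.T2 h4 hy2
    refine .trans _ _ _ ((IH' y hy1 w c' (Or.inl ⟨u, hw1, hy2, hw2, h4⟩)).symm _ _) ?_
    exact back u c (fun v k1 k2 => D.dir_unique h4 h2 k2 k1 h3 h1) w hw2 y hw1 hy1
  rcases he with ⟨u, h1, h2, h3, h4⟩ | ⟨u, h1, h2, h3, h4⟩ | ⟨u, h1, h2, h3, h4⟩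
  · exact (dir u c c' h1 h2 h3 h4).symm _ _
  · exact dir u c' c h2 h1 h4 h3
  · have fwd : ∀ v, D.S u d v → ∀ y, D.precN v y → D.precN y s →
        Relation.EqvGen (D.EdgeLam d) v c' := by
      intro v
      induction v using (D.wf_tri_rev H).induction with
      | _ v IHv =>
      intro hv y hvy hys
      rcases D.T1 hv hvy with ⟨g, g1, g2⟩ | ⟨w, g1, g2⟩
      · refine .trans _ _ _ (IH' y hys v g (Or.inl ⟨u, hvy, g1, hv, g2⟩)) ?_
        rcases D.T1 (s := true) g1 hys with ⟨t', k1, k2⟩ | ⟨y1, k1, k2⟩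
        · have := D.P_eq k1 hts
          subst this
          exact (D.mix_dir h3 h1 g2 k2 h4 h2).elim
        · exact IHv g ⟨by have := D.S_dim g2; omega, .single ⟨y, hvy, g1⟩⟩ g2 y1 k2 k1
      · refine .trans _ _ _ (IH' y hys v w (Or.inr (Or.inr ⟨u, hvy, g1, hv, g2⟩))) ?_
        exact back (!u) c' (fun v k1 k2 => D.mix_unique h3 h1 k2 k1 h4 h2) w g2 y g1 hys
    obtain ⟨y, hy1, hy2⟩ := D.T2 (s := false) h1 hts
    exact fwd c h3 y hy2 hy1

lemma eqv_any_lam (D : DFC α) (d : α) (H : D.AcycAbove (D.dim d)) {c c' : α}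
    (h : Relation.EqvGen (D.EdgeAny d) c c') : Relation.EqvGen (D.EdgeLam d) c c' := by
  induction h with
  | rel x y h => obtain ⟨t, ht⟩ := h; exact D.edge_lam d H t _ _ ht
  | refl x => exact .refl _
  | symm x y _ ih => exact ih.symm _ _
  | trans x y z _ _ ih1 ih2 => exact ih1.trans _ _ _ ih2

lemma conn_lam (D : DFC α) (d : α) (H : D.AcycAbove (D.dim d)) {c c' : α} {s s' : Bool}
    (hc : D.S s d c) (hc' : D.S s' d c') : Relation.EqvGen (D.EdgeLam d) c c' := by
  have d1 := D.S_dim hc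
  have d2 := D.S_dim hc'
  have l1 : D.le c D.top := D.le_top c
  have l2 : D.le c' D.top := D.le_top c'
  have := D.le_dim l1
  by_cases h : D.dim D.top = D.dim d + 1
  · have e1 := D.le_eq_of_dim l1 (by omega)
    have e2 := D.le_eq_of_dim l2 (by omega)
    rw [e1, e2]
    exact .refl _
  · have key := D.conn_any d H (D.dim D.top - D.dim d - 2) D.top (by omega) c c' s s' hc hc' l1 l2
    exact D.eqv_any_lam d H key

def stp (D : DFC α) (d : α) (s : Bool) (c c' : α) : Prop :=
  ∃ t, D.Lam t ∧ D.precN c t ∧ D.precP c' t ∧ D.S s d c ∧ D.S s d c'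

def LE (D : DFC α) (d : α) (s : Bool) : α → α → Prop := Relation.ReflTransGen (D.stp d s)

def Q (D : DFC α) (d : α) (s : Bool) (c c' : α) : Prop :=
  (D.S s d c' ∧ (D.LE d s c c' ∨ D.LE d s c' c)) ∨
  (D.S (!s) d c' ∧ ∃ t c1 c1', D.Lam t ∧ D.precN c1 t ∧ D.precN c1' t ∧ D.S s d c1 ∧
    D.S (!s) d c1' ∧ D.LE d s c c1 ∧ D.LE d (!s) c' c1')

def UqAbove (D : DFC α) (m : ℕ) : Prop := ∀ c, m < D.dim c → D.Uq c

lemma stp_in (D : DFC α) {d v a b : α} {s : Bool} (HU : D.UqAbove (D.dim d))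
    (h1 : D.stp d s a v) (h2 : D.stp d s b v) : a = b := by
  obtain ⟨t, l, n, p, sa, sv⟩ := h1
  obtain ⟨t', l', n', p', sb, sv'⟩ := h2
  have := HU v (by have := D.S_dim sv; omega) true t t' l l' p p'
  subst this
  exact D.dir_unique sv p sa n sb n'

lemma stp_out (D : DFC α) {d v a b : α} {s : Bool} (HU : D.UqAbove (D.dim d))
    (h1 : D.stp d s v a) (h2 : D.stp d s v b) : a = b := by
  obtain ⟨t, l, n, p, sv, _⟩ := h1
  obtain ⟨t', l', n', p', _, _⟩ := h2
  have := HU v (by have := D.S_dim sv; omega) false t t' l l' n n'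
  subst this
  exact D.P_eq p p'

lemma stp_mix (D : DFC α) {d v a w t : α} {s : Bool} (HU : D.UqAbove (D.dim d))
    (h1 : D.stp d s v a) (l' : D.Lam t) (n' : D.precN v t) (hw : D.precN w t)
    (hs : D.S (!s) d w) : False := by
  obtain ⟨t', l, n, p, sv, sa⟩ := h1
  have := HU v (by have := D.S_dim sv; omega) false t t' l' l n' n
  subst this
  exact D.mix_dir sv n sa p hs hw

lemma edge_symm (D : DFC α) {d c c' : α} (h : D.EdgeLam d c c') : D.EdgeLam d c' c := by
  obtain ⟨t, l, ⟨s, h1, h2, h3, h4⟩ | ⟨s, h1, h2, h3, h4⟩ | ⟨s, h1, h2, h3, h4⟩⟩ := h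
  · exact ⟨t, l, Or.inr (Or.inl ⟨s, h2, h1, h4, h3⟩)⟩
  · exact ⟨t, l, Or.inl ⟨s, h2, h1, h4, h3⟩⟩
  · exact ⟨t, l, Or.inr (Or.inr ⟨!s, h2, h1, h4, by simpa using h3⟩)⟩

lemma Q_step (D : DFC α) {d c c' c'' : α} {s : Bool} (HU : D.UqAbove (D.dim d))
    (hQ : D.Q d s c c') (he : D.EdgeLam d c' c'') : D.Q d s c c'' := by
  have he' : ∃ u, D.S u d c' ∧ ((D.stp d u c' c'' ∧ D.S u d c'') ∨
      (D.stp d u c'' c' ∧ D.S u d c'') ∨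
      (D.S (!u) d c'' ∧ ∃ t, D.Lam t ∧ D.precN c' t ∧ D.precN c'' t)) := by
    obtain ⟨t, l, ⟨s, h1, h2, h3, h4⟩ | ⟨s, h1, h2, h3, h4⟩ | ⟨s, h1, h2, h3, h4⟩⟩ := he
    · exact ⟨s, h3, Or.inl ⟨⟨t, l, h1, h2, h3, h4⟩, h4⟩⟩
    · exact ⟨s, h3, Or.inr (Or.inl ⟨⟨t, l, h2, h1, h4, h3⟩, h4⟩)⟩
    · exact ⟨s, h3, Or.inr (Or.inr ⟨h4, t, l, h1, h2⟩)⟩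
  obtain ⟨u, hu, he⟩ := he'
  rcases hQ with ⟨hs, hQ⟩ | ⟨hs, t, c1, c1', l, n1, n2, s1, s2, L1, L2⟩
  · have e := D.S_sign hu hs
    subst e
    rcases he with ⟨he, hs'⟩ | ⟨he, hs'⟩ | ⟨hs', t, l, n1, n2⟩
    · refine Or.inl ⟨hs', ?_⟩
      rcases hQ with hQ | hQ
      · exact Or.inl (hQ.tail he)
      · rcases Relation.ReflTransGen.cases_head hQ with h | ⟨w, h1, h2⟩
        · subst h; exact Or.inl (.single he)
        · rw [D.stp_out HU he h1]
          exact Or.inr h2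
    · refine Or.inl ⟨hs', ?_⟩
      rcases hQ with hQ | hQ
      · rcases Relation.ReflTransGen.cases_tail hQ with h | ⟨w, h1, h2⟩
        · subst h; exact Or.inr (.single he)
        · rw [D.stp_in HU he h2]
          exact Or.inl h1
      · exact Or.inr (.head he hQ)
    · refine Or.inr ⟨hs', ?_⟩
      rcases hQ with hQ | hQ
      · exact ⟨t, c', c'', l, n1, n2, hs, hs', hQ, .refl⟩
      · rcases Relation.ReflTransGen.cases_head hQ with h | ⟨w, h1, h2⟩
        · subst h; exact ⟨t, c', c'', l, n1, n2, hs, hs', .refl, .refl⟩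
        · exact (D.stp_mix HU h1 l n1 n2 hs').elim
  · have e := D.S_sign hu hs
    subst e
    rcases he with ⟨he, hs'⟩ | ⟨he, hs'⟩ | ⟨hs', t', l', m1, m2⟩
    · refine Or.inr ⟨hs', t, c1, c1', l, n1, n2, s1, s2, L1, ?_⟩
      rcases Relation.ReflTransGen.cases_head L2 with h | ⟨w, h1, h2⟩
      · subst h
        exact (D.stp_mix HU he l n2 n1 (by simpa using s1)).elim
      · rw [D.stp_out HU he h1]
        exact h2
    · exact Or.inr ⟨hs', t, c1, c1', l, n1, n2, s1, s2, L1, .head he L2⟩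
    · rcases Relation.ReflTransGen.cases_head L2 with h | ⟨w, h1, h2⟩
      · subst h
        have := HU c' (by have := D.S_dim hs; omega) false t t' l l' n2 m1
        subst this
        have e2 : c'' = c1 := D.mix_unique hs n2 hs' m2 (by simpa using s1) n1
        subst e2
        exact Or.inl ⟨s1, Or.inl L1⟩
      · exact (D.stp_mix HU h1 l' m1 m2 hs').elim

lemma Q_all (D : DFC α) {d c c' : α} {s s' : Bool} (H : D.AcycAbove (D.dim d))
    (HU : D.UqAbove (D.dim d)) (hc : D.S s d c) (hc' : D.S s' d c') : D.Q d s c c' := by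
  have key : ∀ x y, Relation.EqvGen (D.EdgeLam d) x y → (D.Q d s c x ↔ D.Q d s c y) := by
    intro x y h
    induction h with
    | rel x y h => exact ⟨fun q => D.Q_step HU q h, fun q => D.Q_step HU q (D.edge_symm h)⟩
    | refl x => exact Iff.rfl
    | symm x y _ ih => exact ih.symm
    | trans x y z _ _ ih1 ih2 => exact ih1.trans ih2
  exact (key c c' (D.conn_lam d H hc hc')).1 (Or.inl ⟨hc, Or.inl .refl⟩)

lemma Q_same (D : DFC α) {d c c' : α} {s : Bool} (H : D.AcycAbove (D.dim d))
    (HU : D.UqAbove (D.dim d)) (hc : D.S s d c) (hc' : D.S s d c') :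
    D.LE d s c c' ∨ D.LE d s c' c := by
  rcases D.Q_all H HU hc hc' with ⟨_, h⟩ | ⟨h, _⟩
  · exact h
  · have := D.S_sign hc' h
    simp at this

lemma uq_of (D : DFC α) {d : α} (H : D.AcycAbove (D.dim d))
    (HU : D.UqAbove (D.dim d)) : D.Uq d := by
  have key : ∀ s t t', D.Lam t' → D.LE d s t t' → t = t' := by
    intro s t t' l h
    rcases Relation.ReflTransGen.cases_tail h with h | ⟨w, _, ⟨y, _, _, p, _⟩⟩
    · exact h.symm
    · exact (l y p).elim
  intro s t t' l l' h h'
  rcases D.Q_same H HU h h' with h | h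
  · exact key s t t' l' h
  · exact (key s t' t l h).symm

lemma out_exists (D : DFC α) {d c c' : α} {s : Bool} (H : D.AcycAbove (D.dim d))
    (HU : D.UqAbove (D.dim d)) (hc : D.S s d c) (hc' : D.S (!s) d c') :
    ∃ t, D.Lam t ∧ D.precN c t := by
  rcases D.Q_all H HU hc hc' with ⟨h, _⟩ | ⟨_, t, c1, c1', l, n1, n2, s1, s2, L1, L2⟩
  · have := D.S_sign h hc'
    simp at this
  · rcases Relation.ReflTransGen.cases_head L1 with h | ⟨w, ⟨t', l', n', _⟩, _⟩
    · subst h; exact ⟨t, l, n1⟩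
    · exact ⟨t', l', n'⟩

noncomputable def ht (D : DFC α) (x : α) : ℕ := Set.ncard {y | Relation.TransGen D.tri x y}

lemma ht_lt (D : DFC α) {m : ℕ} (H : D.AcycAbove m) {x y : α} (hx : m < D.dim x)
    (h : D.tri x y) : D.ht y < D.ht x := by
  apply Set.ncard_lt_ncard _ (Set.toFinite _)
  refine ⟨fun z hz => Relation.TransGen.head h hz, fun hs => ?_⟩
  have : y ∈ {z | Relation.TransGen D.tri y z} := hs (Relation.TransGen.single h)
  exact H y (by have := D.tri_dim h; omega) this

lemma stp_tri (D : DFC α) {d c c' : α} {s : Bool} (h : D.stp d s c c') : D.tri c c' := by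
  obtain ⟨t, _, n, p, _⟩ := h
  exact ⟨t, n, p⟩

lemma ht_le (D : DFC α) {d c c' : α} {s : Bool} (h : D.LE d s c c') : D.ht c' ≤ D.ht c := by
  unfold LE at h
  induction h with
  | refl => exact le_rfl
  | tail _ h ih =>
    refine le_trans ?_ ih
    exact Set.ncard_le_ncard (fun z hz => Relation.TransGen.head (D.stp_tri h) hz)
      (Set.toFinite _)

lemma adj_claim (D : DFC α) {d c c' t : α} {s : Bool} (H : D.AcycAbove (D.dim d))
    (HU : D.UqAbove (D.dim d)) (ht : D.Lam t) (hct : D.precN c t) (hc : D.S s d c)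
    (hc' : D.S (!s) d c')
    (hmax : ∀ t', D.Lam t' → D.precN c' t' → D.ht (D.tgt t') ≤ D.ht (D.tgt t)) :
    (∃ g, D.precP g t ∧ D.S s d g) ∨ D.precN c' t := by
  rcases D.T1 hc hct with h | ⟨c1, n1, s1⟩
  · exact Or.inl h
  right
  have d1 := D.S_dim s1
  have d2 := D.dim_precN n1
  rcases D.Q_same H HU hc' s1 with h | h
  · rcases Relation.ReflTransGen.cases_head h with h | ⟨w, ⟨t', l', n', p', _⟩, h2⟩
    · rw [h]; exact n1
    · have e := D.precP_unique p'
      have h3 := hmax t' l' n'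
      have h4 := D.ht_le h2
      have h5 := D.ht_lt (m := D.dim d) H (x := c1) (y := D.tgt t) (by omega)
        ⟨t, n1, D.tgt_precP t (by omega)⟩
      rw [e] at h4
      omega
  · rcases Relation.ReflTransGen.cases_head h with h | ⟨w, h1, h2⟩
    · rw [← h]; exact n1
    · exact (D.stp_mix HU h1 ht n1 hct (by simpa using hc)).elim

def Path (D : DFC α) : α → List α → α → Prop
  | d, [], e => d = e
  | d, c :: L, e => D.precN d c ∧ Path D (D.tgt c) L e

lemma path_append (D : DFC α) {d e : α} {A B : List α} :
    D.Path d (A ++ B) e ↔ ∃ f, D.Path d A f ∧ D.Path f B e := by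
  induction A generalizing d with
  | nil => simp [Path]
  | cons a A ih => simp [Path, ih, and_assoc]

lemma path_dim (D : DFC α) {d e : α} {L : List α} (h : D.Path d L e) :
    D.dim e = D.dim d ∧ ∀ c ∈ L, D.dim c = D.dim d + 1 := by
  induction L generalizing d with
  | nil => simp only [Path] at h; subst h; simp
  | cons a A ih =>
    obtain ⟨h1, h2⟩ := h
    have e1 := D.dim_precN h1
    have e2 := D.dim_precP (D.tgt_precP a (by omega))
    have := ih h2
    refine ⟨by omega, ?_⟩
    intro c hc
    rcases List.mem_cons.1 hc with rfl | hc
    · exact e1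
    · have := this.2 c hc; omega

lemma path_last (D : DFC α) {d e b : α} {L : List α} (h : D.Path d (L ++ [b]) e) :
    D.S true e b := by
  have h1 := (D.path_dim h).2 b (by simp)
  obtain ⟨f, _, h2, h3⟩ := D.path_append.1 h
  simp only [Path] at h3
  rw [← h3]
  exact D.tgt_precP b (by omega)

lemma path_of_transGen (D : DFC α) {d e : α} (h : Relation.TransGen D.tri d e) :
    ∃ L, L ≠ [] ∧ D.Path d L e := by
  induction h using Relation.TransGen.head_induction_on with
  | single h =>
    obtain ⟨t, h1, h2⟩ := h
    exact ⟨[t], by simp, h1, (D.precP_unique h2).symm⟩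
  | head h _ ih =>
    obtain ⟨t, h1, h2⟩ := h
    obtain ⟨L, _, hL⟩ := ih
    refine ⟨t :: L, by simp, h1, ?_⟩
    rw [← D.precP_unique h2]
    exact hL

lemma seq_of_transGen {r : α → α → Prop} {a b : α} (h : Relation.TransGen r a b) :
    ∃ p : ℕ, 1 ≤ p ∧ ∃ y : ℕ → α, y 1 = a ∧ y (p + 1) = b ∧
      ∀ i, 1 ≤ i → i ≤ p → r (y i) (y (i + 1)) := by
  induction h with
  | @single b h =>
    refine ⟨1, le_rfl, fun i => if i = 1 then a else b, by simp, by simp, ?_⟩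
    intro i h1 h2
    have : i = 1 := by omega
    subst this
    simpa using h
  | @tail b c _ h ih =>
    obtain ⟨p, hp, y, y1, y2, hy⟩ := ih
    refine ⟨p + 1, by omega, fun i => if i = p + 2 then c else y i, ?_, by simp, ?_⟩
    · have : ¬ (1 = p + 2) := by omega
      simp [y1]
    · intro i h1 h2
      by_cases hi : i = p + 1
      · subst hi
        simpa [y2] using h
      · have e1 : ¬ (i = p + 2) := by omega
        have e2 : ¬ (i + 1 = p + 2) := by omega
        simp only [e1, e2, if_false]
        exact hy i h1 (by omega)

lemma no_cycle' (D : DFC α) {x a : α}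
    (h : Relation.TransGen (fun a b => D.precN a x ∧ D.precN (D.tgt b) a) a a) : False := by
  obtain ⟨p, hp, y, y1, y2, hy⟩ := seq_of_transGen h
  exact D.no_cycle x p hp y (fun i h1 h2 => (hy i h1 h2).1) (y2.trans y1.symm)
    (fun i h1 h2 => (hy i h1 h2).2)

lemma path_trans (D : DFC α) {x c c0 e : α} {L : List α} (h : D.Path (D.tgt c) L e)
    (hL : ∀ a ∈ L, D.precN a x) (h1 : D.precN e c0) (h2 : D.precN c0 x) :
    Relation.TransGen (fun a b => D.precN a x ∧ D.precN (D.tgt b) a) c0 c := by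
  induction L generalizing c with
  | nil =>
    simp only [Path] at h
    subst h
    exact .single ⟨h2, h1⟩
  | cons a A ih =>
    obtain ⟨k1, k2⟩ := h
    exact (ih k2 (fun b hb => hL b (by simp [hb]))).tail ⟨hL a (by simp), k1⟩

lemma split_first {p : α → Prop} {L : List α} (h : ∃ x ∈ L, p x) :
    ∃ A c B, L = A ++ c :: B ∧ (∀ a ∈ A, ¬ p a) ∧ p c := by
  induction L with
  | nil => simp at h
  | cons a L ih =>
    by_cases ha : p a
    · exact ⟨[], a, L, rfl, by simp, ha⟩
    · have : ∃ x ∈ L, p x := by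
        obtain ⟨x, hx, hp⟩ := h
        rcases List.mem_cons.1 hx with rfl | hx
        · exact absurd hp ha
        · exact ⟨x, hx, hp⟩
      obtain ⟨A, c, B, e, h1, h2⟩ := ih this
      refine ⟨a :: A, c, B, by simp [e], ?_, h2⟩
      intro b hb
      rcases List.mem_cons.1 hb with rfl | hb
      · exact ha
      · exact h1 b hb

def Closed (D : DFC α) (m : ℕ) (L : List α) : Prop := ∃ d, D.dim d = m ∧ D.Path d L d

lemma closed_rotate (D : DFC α) {m : ℕ} {A B : List α} (h : D.Closed m (A ++ B)) :
    D.Closed m (B ++ A) := by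
  obtain ⟨d, hd, h⟩ := h
  obtain ⟨f, h1, h2⟩ := D.path_append.1 h
  exact ⟨f, by rw [← hd]; exact (D.path_dim h1).1, D.path_append.2 ⟨d, h2, h1⟩⟩

lemma closed_reduce (D : DFC α) {m : ℕ} (H : D.AcycAbove m) (HU : D.UqAbove m) {L : List α}
    (hne : L ≠ []) (hL : D.Closed m L) :
    ∃ L', L' ≠ [] ∧ D.Closed m L' ∧ (L'.map D.ht).sum < (L.map D.ht).sum := by
  obtain ⟨t, htL, ⟨cr, hcr, hcrt⟩, hmax⟩ : ∃ t, D.Lam t ∧ (∃ c ∈ L, D.precN c t) ∧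
      ∀ c ∈ L, ∀ t', D.Lam t' → D.precN c t' → D.ht (D.tgt t') ≤ D.ht (D.tgt t) := by
    have hnon : ({t | D.Lam t ∧ ∃ c ∈ L, D.precN c t} : Set α).Nonempty := by
      obtain ⟨d, rfl, hp⟩ := hL
      rcases List.eq_nil_or_concat L with h | ⟨M, b, h⟩
      · exact absurd h hne
      · have hb : D.S true d b := by
          rw [h] at hp; exact D.path_last (by simpa using hp)
        cases L with
        | nil => exact absurd rfl hne
        | cons c L' =>
          obtain ⟨t, h1, h2⟩ := D.out_exists H HU (s := true) (c' := c) hb hp.1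
          exact ⟨t, h1, b, by rw [h]; simp, h2⟩
    obtain ⟨t, ⟨h1, h2⟩, h3⟩ := Set.exists_max_image _ (fun t => D.ht (D.tgt t))
      (Set.toFinite _) hnon
    exact ⟨t, h1, h2, fun c hc t' l n => h3 t' ⟨l, c, hc, n⟩⟩
  obtain ⟨c0, hc0, hc0t⟩ : ∃ c0 ∈ L, ¬ D.precN c0 t := by
    by_contra hcon
    push Not at hcon
    obtain ⟨d, _, hp⟩ := hL
    cases L with
    | nil => exact hne rfl
    | cons c L' =>
      exact D.no_cycle' (D.path_trans hp.2 (fun a ha => hcon a (by simp [ha])) hp.1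
        (hcon c (by simp)))
  obtain ⟨L1, L2, rfl⟩ := List.append_of_mem hc0
  have hL' : D.Closed m (c0 :: (L2 ++ L1)) := D.closed_rotate hL
  obtain ⟨A, c, B, e, hA, hc⟩ := split_first (p := fun x => D.precN x t) (L := L2 ++ L1) (by
    refine ⟨cr, ?_, hcrt⟩
    have : cr ≠ c0 := by rintro rfl; exact hc0t hcrt
    simp [this] at hcr ⊢
    tauto)
  rw [e] at hL'
  have hL2 : D.Closed m ((c :: B) ++ (c0 :: A)) := D.closed_rotate (A := c0 :: A) hL'
  obtain ⟨R, a, N, e2, hR, ha⟩ := split_first (p := fun x => ¬ D.precN x t) (L := B ++ c0 :: A)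
    ⟨c0, by simp, hc0t⟩
  have e3 : (c :: B) ++ (c0 :: A) = (c :: R) ++ (a :: N) := by simp [e2]
  have hperm : (L1 ++ c0 :: L2).Perm ((c :: R) ++ (a :: N)) := by
    rw [← e3]
    refine (List.perm_append_comm).trans ?_
    have : c0 :: L2 ++ L1 = (c0 :: A) ++ (c :: B) := by simp [e]
    rw [this]
    exact List.perm_append_comm
  obtain ⟨b, M, hb, hbt⟩ : ∃ b M, (c :: R) ++ (a :: N) = M ++ [b] ∧ ¬ D.precN b t := by
    rcases List.eq_nil_or_concat (c0 :: A) with h | ⟨M, b, h⟩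
    · simp at h
    · refine ⟨b, (c :: B) ++ M, ?_, ?_⟩
      · rw [← e3, h]; simp
      · have : b ∈ c0 :: A := by rw [h]; simp
        rcases List.mem_cons.1 this with rfl | hb
        · exact hc0t
        · exact hA b hb
  rw [e3] at hL2
  obtain ⟨d, rfl, hp⟩ := hL2
  have hbd : D.S true d b := D.path_last (hb ▸ hp)
  have hbmem : b ∈ L1 ++ c0 :: L2 := hperm.mem_iff.2 (by rw [hb]; simp)
  have hamem : a ∈ L1 ++ c0 :: L2 := hperm.mem_iff.2 (by simp)
  have hdc : D.S false d c := hp.1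
  obtain ⟨f, hp1, hp2⟩ := D.path_append.1 hp
  have hfd := (D.path_dim hp1).1
  obtain ⟨g, hg, hdg⟩ := (D.adj_claim H HU htL hc hdc hbd (hmax b hbmem)).resolve_right hbt
  obtain ⟨l, hlt, hfl⟩ : ∃ l, D.precN l t ∧ D.S true f l := by
    rcases List.eq_nil_or_concat (c :: R) with h | ⟨M, l, h⟩
    · simp at h
    · refine ⟨l, ?_, ?_⟩
      · have : l ∈ c :: R := by rw [h]; simp
        rcases List.mem_cons.1 this with rfl | hl
        · exact hc
        · exact not_not.1 (hR l hl)
      · rw [h] at hp1; exact D.path_last (by simpa using hp1)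
  obtain ⟨g', hg', hfg⟩ := (D.adj_claim (d := f) (s := true) (c' := a) (by rw [hfd]; exact H)
    (by rw [hfd]; exact HU) htL hlt hfl hp2.1 (hmax a hamem)).resolve_right ha
  have := D.P_eq hg hg'
  subst this
  refine ⟨g :: a :: N, by simp, ⟨d, rfl, hdg, ?_⟩, ?_⟩
  · rw [← D.precP_unique hfg]; exact hp2
  · rw [(hperm.map D.ht).sum_eq]
    have := D.ht_lt H (x := c) (y := g) (by have := D.S_dim hdc; omega) ⟨t, hc, hg⟩
    simp
    omega

lemma no_closed (D : DFC α) {m : ℕ} (H : D.AcycAbove m) (HU : D.UqAbove m) (w : ℕ) :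
    ∀ L : List α, (L.map D.ht).sum = w → L ≠ [] → ¬ D.Closed m L := by
  induction w using Nat.strong_induction_on with
  | _ w ih =>
  intro L hw hne hL
  obtain ⟨L', h1, h2, h3⟩ := D.closed_reduce H HU hne hL
  exact ih _ (hw ▸ h3) L' rfl h1 h2

lemma main (D : DFC α) (k : ℕ) : ∀ x, D.dim D.top ≤ D.dim x + k →
    ¬ Relation.TransGen D.tri x x ∧ D.Uq x := by
  induction k with
  | zero =>
    intro x hx
    have hno : ∀ s t, ¬ D.S s x t := by
      intro s t h
      have := D.S_dim h
      have := D.le_dim (D.le_top t)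
      omega
    refine ⟨fun h => ?_, fun s t _ _ _ h => (hno s t h).elim⟩
    obtain ⟨L, hne, hL⟩ := D.path_of_transGen h
    cases L with
    | nil => exact hne rfl
    | cons c L => exact hno false c hL.1
  | succ k ih =>
    intro x hx
    have H : D.AcycAbove (D.dim x) := fun y hy => (ih y (by omega)).1
    have HU : D.UqAbove (D.dim x) := fun y hy => (ih y (by omega)).2
    refine ⟨fun h => ?_, D.uq_of H HU⟩
    obtain ⟨L, hne, hL⟩ := D.path_of_transGen h
    exact D.no_closed H HU _ L rfl hne ⟨x, rfl, hL⟩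

end DFC

/-- `<⁺` is irreflexive, hence (being transitive as a transitive
closure) a strict partial order on `C`. -/
theorem dfc_ltP_strict_order {α : Type*} [Fintype α] (D : DFC α) :
    (∀ x : α, ¬ D.ltP x x) ∧
    (∀ x y z : α, D.ltP x y → D.ltP y z → D.ltP x z) := by
  exact ⟨fun x => (D.main (D.dim D.top) x (by omega)).1, fun _ _ _ h1 h2 => h1.trans h2⟩
end

section
/- Sources partition theorem: let C be a dendritic face complex and let 0 ≤ k ≤ n−1. Then C_k \ {γ^{(k)}ω} is the disjoint union of the sets δ(c) for c ∈ Λ_{k+1}: every d ∈ C_k with d ≠ γ^{(k)}ω belongs to δ(c) for exactly one c ∈ Λ_{k+1}, and γ^{(k)}ω belongs to δ(c) for no c ∈ Λ_{k+1}. -/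
open Relation

theorem wf_of_acyclic {α : Type*} [Finite α] (r : α → α → Prop)
    (h : ∀ a, ¬ TransGen r a a) : WellFounded r := by
  have : Std.Irrefl (TransGen r) := ⟨h⟩
  exact Subrelation.wf (fun h => TransGen.single h)
    (Finite.wellFounded_of_trans_of_irrefl (TransGen r))

theorem transGen_mono_aux {α : Type*} {r s : α → α → Prop} (h : ∀ a b, r a b → s a b) {a b : α}
    (hab : TransGen r a b) : TransGen s a b := by
  induction hab with
  | single h1 => exact .single (h _ _ h1)
  | tail _ h1 ih => exact ih.tail (h _ _ h1)

theorem wf_swap_of_acyclic {α : Type*} [Finite α] (r : α → α → Prop)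
    (h : ∀ a, ¬ TransGen r a a) : WellFounded (Function.swap r) :=
  wf_of_acyclic _ fun a ha => h a (transGen_swap.1 ha)

namespace DFC

variable {α : Type*} [Fintype α] (D : DFC α)

/-- Unsigned face relation. -/
def pr (y x : α) : Prop := D.precN y x ∨ D.precP y x

/-- Face order. -/
def fle (y x : α) : Prop := ReflTransGen D.pr y x

/-- `y` is strictly between `z` and `x`. -/
def mid (z x y : α) : Prop := D.pr z y ∧ D.pr y x

variable {D}

theorem pr_dim {y x : α} (h : D.pr y x) : D.dim x = D.dim y + 1 :=
  h.elim D.dim_precN D.dim_precP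

theorem fle_dim {y x : α} (h : D.fle y x) : D.dim y ≤ D.dim x := by
  induction h with
  | refl => exact le_rfl
  | tail _ h ih => have := pr_dim h; omega

theorem fle_eq {y x : α} (h : D.fle y x) (hd : D.dim x ≤ D.dim y) : y = x := by
  rcases ReflTransGen.cases_tail h with h | ⟨z, h1, h2⟩
  · exact h.symm
  · have := pr_dim h2; have := fle_dim h1; omega

theorem fle_facet {y x : α} (h : D.fle y x) (hd : D.dim y < D.dim x) :
    ∃ z, D.fle y z ∧ D.pr z x := by
  rcases ReflTransGen.cases_tail h with h | ⟨z, h1, h2⟩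
  · subst h; omega
  · exact ⟨z, h1, h2⟩

theorem fle_coface {y x : α} (h : D.fle y x) (hd : D.dim y < D.dim x) :
    ∃ z, D.pr y z ∧ D.fle z x := by
  rcases ReflTransGen.cases_head h with h | ⟨z, h1, h2⟩
  · subst h; omega
  · exact ⟨z, h1, h2⟩

theorem fle_tp (x : α) : D.fle x D.top := D.le_top x

theorem pr_sprec {y x : α} : D.pr y x ↔ ∃ a, sprec D.precN D.precP a y x := by
  constructor
  · rintro (h | h)
    · exact ⟨false, h⟩
    · exact ⟨true, h⟩
  · rintro ⟨a, h⟩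
    cases a
    · exact Or.inl h
    · exact Or.inr h

theorem sprec_unique {y x : α} {a b : Bool} (h : sprec D.precN D.precP a y x)
    (h' : sprec D.precN D.precP b y x) : a = b := by
  cases a <;> cases b
  · rfl
  · exact absurd ⟨h, h'⟩ (D.not_both y x)
  · exact absurd ⟨h', h⟩ (D.not_both y x)
  · rfl

/-- The middle faces with a given sign product are unique. -/
theorem thin_uniq {a b a' b' : Bool} {x y y' z : α}
    (h1 : sprec D.precN D.precP b z y) (h2 : sprec D.precN D.precP a y x)
    (h1' : sprec D.precN D.precP b' z y') (h2' : sprec D.precN D.precP a' y' x)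
    (h : (a = b) ↔ (a' = b')) : y = y' := by
  obtain ⟨w, ⟨hw, c, e, hwe, hwc, hs⟩, -⟩ := D.thin a b x y z h1 h2
  have aux : ∀ {a b : Bool} {y : α}, sprec D.precN D.precP b z y →
      sprec D.precN D.precP a y x → ((a = b) ↔ ¬ (c = e)) → y ≠ w := by
    intro a b y h1 h2 h he
    subst he
    have := sprec_unique h1 hwe
    have := sprec_unique h2 hwc
    subst_vars
    tauto
  obtain ⟨v, -, hv⟩ := D.thin c e x w z hwe hwc
  rw [hv y ⟨aux h1 h2 hs, a, b, h1, h2, by tauto⟩,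
    hv y' ⟨aux h1' h2' (by tauto), a', b', h1', h2', by tauto⟩]

theorem mid_two {z x y : α} (h : D.mid z x y) :
    ∃ y', y' ≠ y ∧ D.mid z x y' ∧ ∀ w, D.mid z x w → w = y ∨ w = y' := by
  obtain ⟨b, h1⟩ := pr_sprec.1 h.1
  obtain ⟨a, h2⟩ := pr_sprec.1 h.2
  obtain ⟨y', ⟨hne, c, e, h3, h4, hs⟩, -⟩ := D.thin a b x y z h1 h2
  refine ⟨y', hne, ⟨pr_sprec.2 ⟨_, h3⟩, pr_sprec.2 ⟨_, h4⟩⟩, fun w hw => ?_⟩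
  obtain ⟨b', h1'⟩ := pr_sprec.1 hw.1
  obtain ⟨a', h2'⟩ := pr_sprec.1 hw.2
  by_cases hab : (a = b) ↔ (a' = b')
  · exact Or.inl (thin_uniq h1 h2 h1' h2' hab).symm
  · exact Or.inr (thin_uniq h3 h4 h1' h2' (by tauto)).symm

theorem mid_third {z x y y' w : α} (h : D.mid z x y) (h' : D.mid z x y') (hw : D.mid z x w)
    (hne : y ≠ y') (hwy : w ≠ y) : w = y' := by
  obtain ⟨v, -, -, hv⟩ := mid_two h
  rcases hv _ h' with h1 | h1
  · exact absurd h1.symm hne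
  rcases hv _ hw with h2 | h2
  · exact absurd h2 hwy
  rw [h1, h2]

theorem thinNN {z y x : α} (h1 : D.precN z y) (h2 : D.precN y x) :
    ∃ y', y' ≠ y ∧ ((D.precP z y' ∧ D.precN y' x) ∨ (D.precN z y' ∧ D.precP y' x)) := by
  obtain ⟨y', ⟨hne, c, e, h3, h4, hs⟩, -⟩ := D.thin false false x y z h1 h2
  refine ⟨y', hne, ?_⟩
  cases c <;> cases e <;> simp at hs
  · exact Or.inl ⟨h3, h4⟩
  · exact Or.inr ⟨h3, h4⟩

theorem thinPN {z y x : α} (h1 : D.precP z y) (h2 : D.precN y x) :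
    ∃ y', y' ≠ y ∧ ((D.precN z y' ∧ D.precN y' x) ∨ (D.precP z y' ∧ D.precP y' x)) := by
  obtain ⟨y', ⟨hne, c, e, h3, h4, hs⟩, -⟩ := D.thin false true x y z h1 h2
  refine ⟨y', hne, ?_⟩
  cases c <;> cases e <;> simp at hs
  · exact Or.inl ⟨h3, h4⟩
  · exact Or.inr ⟨h3, h4⟩

theorem thinNP {z y x : α} (h1 : D.precN z y) (h2 : D.precP y x) :
    ∃ y', D.precN z y' ∧ D.precN y' x := by
  obtain ⟨y', ⟨hne, c, e, h3, h4, hs⟩, -⟩ := D.thin true false x y z h1 h2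
  cases c <;> cases e <;> simp at hs
  · exact ⟨y', h3, h4⟩
  · exact absurd ((D.precP_unique h4).trans (D.precP_unique h2).symm) hne

theorem precN_ne_tgt {y y' x : α} (h : D.precN y x) (h' : D.precP y' x) : y ≠ y' := by
  rintro rfl; exact D.not_both _ _ ⟨h, h'⟩

/-- A source and the target of `b` containing `d` contain it with the same sign. -/
theorem sign_same {d c c' b : α} (h : D.mid d b c) (h' : D.mid d b c')
    (hc : D.precN c b) (hc' : D.precP c' b) : D.precN d c ↔ D.precN d c' := by
  constructor
  · intro h1
    refine h'.1.resolve_right fun h2 => precN_ne_tgt hc hc' ?_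
    exact thin_uniq (a := false) (b := false) (a' := true) (b' := true) h1 hc h2 hc' (by simp)
  · intro h1
    refine h.1.resolve_right fun h2 => precN_ne_tgt hc hc' ?_
    exact thin_uniq (a := false) (b := true) (a' := true) (b' := false) h2 hc h1 hc' (by simp)

/-- Two distinct sources of `b` containing `d` contain it with opposite signs. -/
theorem sign_diff {d c c' b : α} (h : D.mid d b c) (h' : D.mid d b c')
    (hc : D.precN c b) (hc' : D.precN c' b) (hne : c ≠ c') : D.precN d c ↔ D.precP d c' := by
  constructor
  · intro h1
    refine h'.1.resolve_left fun h2 => hne ?_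
    exact thin_uniq (a := false) (b := false) (a' := false) (b' := false) h1 hc h2 hc' (by simp)
  · intro h1
    refine h.1.resolve_right fun h2 => hne ?_
    exact thin_uniq (a := false) (b := true) (a' := false) (b' := true) h2 hc h1 hc' (by simp)

/-- local order on the sources of `x` -/
def loc (D : DFC α) (x : α) (y' y : α) : Prop :=
  D.precN y x ∧ D.precN y' x ∧ D.precN (D.tgt y') y

theorem loc_seq {x a b : α} (h : TransGen (D.loc x) a b) :
    ∃ p, 1 ≤ p ∧ ∃ f : ℕ → α, f 1 = b ∧ f (p + 1) = a ∧
      ∀ i, 1 ≤ i → i ≤ p → D.loc x (f (i + 1)) (f i) := by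
  induction h using TransGen.head_induction_on with
  | @single a h =>
    refine ⟨1, le_rfl, fun i => if i = 1 then b else a, by simp, by simp, ?_⟩
    intro i h1 h2
    obtain rfl : i = 1 := by omega
    simpa using h
  | @head a c h _ ih =>
    obtain ⟨p, hp, f, h1, h2, h3⟩ := ih
    refine ⟨p + 1, by omega, fun i => if i = p + 2 then a else f i, ?_, by simp, ?_⟩
    · simpa using h1
    · intro i hi hi'
      rcases Nat.lt_or_ge p i with hlt | hge
      · obtain rfl : i = p + 1 := by omega
        simpa [h2] using h
      · have e1 : i + 1 ≠ p + 2 := by omega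
        have e2 : i ≠ p + 2 := by omega
        simp only [e1, e2, if_false]
        exact h3 i hi hge

theorem loc_acyclic (x a : α) : ¬ TransGen (D.loc x) a a := by
  intro h
  obtain ⟨p, hp, f, h1, h2, h3⟩ := loc_seq h
  exact D.no_cycle x p hp f (fun i hi hi' => (h3 i hi hi').1) (h2.trans h1.symm)
    fun i hi hi' => (h3 i hi hi').2.2

/-- Zig-zag towards the target. -/
theorem zig (x : α) (Q E : α → Prop)
    (h1 : ∀ y z, D.precN y x → E z → D.pr z y → ∃ z', D.precN z' y ∧ E z')
    (h2 : ∀ z y y', E z → D.mid z x y → D.mid z x y' → (Q y ↔ Q y')) :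
    ∀ y z, D.precN y x → D.pr z y → E z → ((Q y ↔ Q (D.tgt x)) ∧ ∃ z', E z' ∧ D.pr z' (D.tgt x)) := by
  intro y
  induction y using (wf_of_acyclic _ (D.loc_acyclic x)).induction with
  | _ y ih =>
    intro z hy hz hE
    obtain ⟨w, hw, hEw⟩ := h1 y z hy hE hz
    obtain ⟨y', hne, ⟨h3, h4⟩ | ⟨h3, h4⟩⟩ := thinNN hw hy
    · have hl : D.loc x y' y := ⟨hy, h4, by rwa [← D.precP_unique h3]⟩
      have := ih y' hl w h4 (Or.inr h3) hEw
      refine ⟨?_, this.2⟩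
      rw [← this.1]
      exact h2 w y y' hEw ⟨Or.inl hw, Or.inl hy⟩ ⟨Or.inr h3, Or.inl h4⟩
    · rw [← D.precP_unique h4]
      exact ⟨h2 w y y' hEw ⟨Or.inl hw, Or.inl hy⟩ ⟨Or.inl h3, Or.inr h4⟩, w, hEw, Or.inl h3⟩

/-- Generic connectivity. -/
theorem conn (j : ℕ) (F S : α → Prop) (hF : ∀ c, F c → D.dim c = j)
    (hS : ∀ x c c', D.dim x = j + 1 → F c → F c' → D.pr c x → D.pr c' x → (S c ↔ S c'))
    (hE : ∀ x y c, j + 2 ≤ D.dim x → F c → D.fle c y → D.pr y x → ∃ E : α → Prop,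
      (∃ z, E z ∧ D.pr z y) ∧
      (∀ z y, E z → D.pr z y → D.pr y x → ∃ c, F c ∧ D.fle c z) ∧
      (∀ y z, D.precN y x → E z → D.pr z y → ∃ z', D.precN z' y ∧ E z')) :
    ∀ n x c c', D.dim x = n → F c → F c' → D.fle c x → D.fle c' x → (S c ↔ S c') := by
  intro n
  induction n with
  | zero =>
    intro x c c' hx _ _ h h'
    rw [fle_eq h (by omega), fle_eq h' (by omega)]
  | succ n ih =>
    intro x c c' hx hc hc' h h'
    have hd := hF c hc
    have hd' := hF c' hc'
    rcases Nat.lt_or_ge j (n + 1) with hlt | hge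
    · obtain ⟨y, hy, hyx⟩ := fle_facet h (by omega)
      obtain ⟨y', hy', hyx'⟩ := fle_facet h' (by omega)
      have dy := pr_dim hyx
      have dy' := pr_dim hyx'
      rcases Nat.lt_or_ge (j + 1) (n + 1) with hlt2 | hge2
      · set Q : α → Prop := fun y => ∃ c, F c ∧ D.fle c y ∧ S c with hQ
        have hQiff : ∀ y c, D.pr y x → F c → D.fle c y → (S c ↔ Q y) := by
          intro y c hyx hc hcy
          have := pr_dim hyx
          constructor
          · intro hs; exact ⟨c, hc, hcy, hs⟩
          · rintro ⟨c1, h1, h2, h3⟩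
            exact (ih y c1 c (by omega) h1 hc h2 hcy).1 h3
        have key : ∀ y c, D.pr y x → F c → D.fle c y → (S c ↔ Q (D.tgt x)) := by
          intro y c hyx hc hcy
          rcases hyx with hyx | hyx
          · obtain ⟨E, ⟨z, hz, hzy⟩, hE2, hE3⟩ := hE x y c (by omega) hc hcy (Or.inl hyx)
            rw [hQiff y c (Or.inl hyx) hc hcy]
            refine (zig x Q E hE3 ?_ y z hyx hzy hz).1
            intro z y y' hz hm hm'
            obtain ⟨c0, hc0, hc0z⟩ := hE2 z y hz hm.1 hm.2
            rw [← hQiff y c0 hm.2 hc0 (hc0z.tail hm.1), ← hQiff y' c0 hm'.2 hc0 (hc0z.tail hm'.1)]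
          · rw [← D.precP_unique hyx]
            exact hQiff y c (Or.inr hyx) hc hcy
        rw [key y c hyx hc hy, key y' c' hyx' hc' hy']
      · have e1 := fle_eq hy (by omega)
        have e2 := fle_eq hy' (by omega)
        subst e1 e2
        exact hS x c c' (by omega) hc hc' hyx hyx'
    · rw [fle_eq h (by omega), fle_eq h' (by omega)]

/-- Connectivity of the cofaces of `d`. -/
theorem conn_coface (d : α) (S : α → Prop)
    (hS : ∀ b c c', D.mid d b c → D.mid d b c' → (S c ↔ S c')) (c c' : α)
    (hc : D.pr d c) (hc' : D.pr d c') : S c ↔ S c' := by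
  refine conn (D := D) (D.dim d + 1) (D.pr d) S (fun c hc => pr_dim hc)
    (fun x c c' _ h1 h2 h3 h4 => hS x c c' ⟨h1, h3⟩ ⟨h2, h4⟩) ?_ _ D.top c c' rfl hc hc'
    (fle_tp _) (fle_tp _)
  intro x y c hx hc hcy hyx
  have d1 := pr_dim hc
  have d2 := pr_dim hyx
  obtain ⟨z, hz, hzy⟩ := fle_facet ((ReflTransGen.single hc).trans hcy : D.fle d y) (by omega)
  have d3 := pr_dim hzy
  obtain ⟨e, he, hez⟩ := fle_facet hz (by omega)
  have d4 := pr_dim hez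
  refine ⟨D.pr e, ⟨z, hez, hzy⟩, ?_, ?_⟩
  · intro z y h1 h2 h3
    have := pr_dim h1
    have := fle_dim he
    exact fle_coface (he.tail h1) (by omega)
  · intro y z hy hez hzy
    obtain ⟨z', hne, hm, -⟩ := mid_two ⟨hez, hzy⟩
    rcases hzy with h | h
    · exact ⟨z, h, hez⟩
    · refine ⟨z', hm.2.resolve_right fun h' => hne ?_, hm.1⟩
      rw [D.precP_unique h', D.precP_unique h]

/-- Connectivity of all faces of a given dimension. -/
theorem conn_dim (j : ℕ) (S : α → Prop)
    (hS : ∀ b c c', D.dim c = j → D.pr c b → D.pr c' b → (S c ↔ S c')) (c c' : α)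
    (hc : D.dim c = j) (hc' : D.dim c' = j) : S c ↔ S c' := by
  refine conn (D := D) j (fun c => D.dim c = j) S (fun c hc => hc)
    (fun x c c' _ h1 h2 h3 h4 => hS x c c' h1 h3 h4) ?_ _ D.top c c' rfl hc hc'
    (fle_tp _) (fle_tp _)
  have low : ∀ n z, D.dim z = j + n → ∃ c, D.dim c = j ∧ D.fle c z := by
    intro n
    induction n with
    | zero => intro z hz; exact ⟨z, hz, .refl⟩
    | succ n ih =>
      intro z hz
      obtain ⟨y, hy⟩ := D.src_exists z (by omega)
      obtain ⟨c, h1, h2⟩ := ih y (by have := D.dim_precN hy; omega)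
      exact ⟨c, h1, h2.tail (Or.inl hy)⟩
  intro x y c hx hc hcy hyx
  have d2 := pr_dim hyx
  refine ⟨fun _ => True, ?_, ?_, ?_⟩
  · obtain ⟨z, hz⟩ := D.src_exists y (by omega)
    exact ⟨z, trivial, Or.inl hz⟩
  · intro z y _ h1 h2
    have := pr_dim h1
    have := pr_dim h2
    exact low (D.dim z - j) z (by omega)
  · intro y z hy _ _
    have := D.dim_precN hy
    obtain ⟨z, hz⟩ := D.src_exists y (by omega)
    exact ⟨z, hz, trivial⟩

/-- being the target of no face -/
def Lm (D : DFC α) (b : α) : Prop := ∀ c, ¬ D.precP b c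

/-- The relation `◁` restricted to witnesses in `Λ`. -/
def nx (D : DFC α) (c c' : α) : Prop := ∃ b, D.Lm b ∧ D.precN c b ∧ D.precP c' b

/-- The inductive package at level `j`, without acyclicity. -/
structure HH (D : DFC α) (j : ℕ) : Prop where
  P1 : ∀ d, D.dim d = j → d ≠ D.itTgt j → ∃ b, D.Lm b ∧ D.precN d b
  P2 : ∀ d b b', D.dim d = j → D.Lm b → D.Lm b' → D.precN d b → D.precN d b' → b = b'
  P3 : ∀ b, D.Lm b → ¬ D.precN (D.itTgt j) b
  T1 : ∀ d b b', D.dim d = j → D.Lm b → D.Lm b' → D.precP d b → D.precP d b' → b = b'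
  T2 : ∀ d c, D.dim d = j → D.precP d c → ∃ b, D.Lm b ∧ D.precP d b

/-- Acyclicity at level `j`. -/
def WW (D : DFC α) (j : ℕ) : Prop := ∀ c, D.dim c = j → ¬ TransGen D.nx c c

theorem nx_dim {c c' : α} (h : D.nx c c') : D.dim c = D.dim c' := by
  obtain ⟨b, -, h1, h2⟩ := h
  have := D.dim_precN h1
  have := D.dim_precP h2
  omega

theorem WW.acyclic {j : ℕ} (h : D.WW j) (a : α) :
    ¬ TransGen (fun c c' => D.dim c = j ∧ D.nx c c') a a := by
  intro ha
  have hd : D.dim a = j := by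
    rcases TransGen.head'_iff.1 ha with ⟨c, h1, -⟩
    exact h1.1
  exact h a hd (transGen_mono_aux (fun _ _ h => h.2) ha)

theorem dim_it (i : ℕ) (hi : i ≤ D.dim D.top) : D.dim (D.tgt^[i] D.top) + i = D.dim D.top := by
  induction i with
  | zero => simp
  | succ i ih =>
    have := ih (by omega)
    rw [Function.iterate_succ_apply']
    have := D.dim_precP (D.tgt_precP (D.tgt^[i] D.top) (by omega))
    omega

theorem dim_itTgt {j : ℕ} (hj : j ≤ D.dim D.top) : D.dim (D.itTgt j) = j := by
  have := D.dim_it (D.dim D.top - j) (by omega)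
  unfold itTgt
  omega

theorem itTgt_succ {j : ℕ} (hj : j + 1 ≤ D.dim D.top) :
    D.precP (D.itTgt j) (D.itTgt (j + 1)) := by
  have h := D.tgt_precP (D.itTgt (j + 1)) (by rw [dim_itTgt hj]; omega)
  have e : D.itTgt j = D.tgt (D.itTgt (j + 1)) := by
    unfold itTgt
    rw [← Function.iterate_succ_apply' D.tgt]
    congr 2
    omega
  rwa [e]

theorem mono_tgt (T : α → Prop) (a b : α) (hb : D.precP b a) (hb1 : 1 ≤ D.dim b)
    (hm : ∀ y, D.precN y a → ∀ z, D.precN z y → (T z ↔ T (D.tgt y))) :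
    ∀ z, D.precN z b → (T z ↔ T (D.tgt b)) := by
  have key : ∀ y, D.precN y a → (T (D.tgt y) ↔ T (D.tgt b)) := by
    intro y
    induction y using (wf_swap_of_acyclic _ (D.loc_acyclic a)).induction with
    | _ y ih =>
      intro hy
      have hd : D.dim y = D.dim b := by
        have := D.dim_precN hy
        have := D.dim_precP hb
        omega
      obtain ⟨y', hne, ⟨h3, h4⟩ | ⟨h3, h4⟩⟩ := thinPN (D.tgt_precP y (by omega)) hy
      · rw [hm y' h4 _ h3]
        exact ih y' ⟨h4, hy, h3⟩ h4
      · have e : y' = b := (D.precP_unique h4).trans (D.precP_unique hb).symm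
        subst e
        rw [← D.precP_unique h3]
  intro z hz
  obtain ⟨y, h1, h2⟩ := thinNP hz hb
  rw [hm y h2 z h1, key y h2]

theorem reach {j : ℕ} (hj : j ≤ D.dim D.top) (H : D.HH j) (W1 : D.WW (j + 1)) (H1 : D.HH (j + 1))
    (c : α) (hc : D.dim c = j) : ReflTransGen D.nx c (D.itTgt j) := by
  set T : α → Prop := fun c => ReflTransGen D.nx c (D.itTgt j) with hT
  have ha : ∀ b, D.Lm b → D.dim b = j + 1 → ∀ z, D.precN z b → (T z ↔ T (D.tgt b)) := by
    intro b hL hb z hz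
    have hd := D.dim_precN hz
    constructor
    · intro h
      rcases ReflTransGen.cases_head h with h | ⟨c', ⟨b', hL', h1, h2⟩, h3⟩
      · rw [h] at hz
        exact absurd hz (H.P3 b hL)
      · have e := H.P2 z b b' (by omega) hL hL' hz h1
        subst e
        rw [← D.precP_unique h2]
        exact h3
    · intro h
      exact ReflTransGen.head ⟨b, hL, hz, D.tgt_precP b (by omega)⟩ h
  have hb : ∀ b, D.dim b = j + 1 → ∀ z, D.precN z b → (T z ↔ T (D.tgt b)) := by
    intro b
    induction b using (wf_of_acyclic _ W1.acyclic).induction with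
    | _ b ih =>
      intro hb
      by_cases hL : D.Lm b
      · exact ha b hL hb
      · unfold Lm at hL
        push Not at hL
        obtain ⟨a0, ha0⟩ := hL
        obtain ⟨a, haL, hab⟩ := H1.T2 b a0 hb ha0
        refine mono_tgt T a b hab (by omega) fun y hy => ?_
        have hdy : D.dim y = j + 1 := by
          have := D.dim_precN hy
          have := D.dim_precP hab
          omega
        exact ih y ⟨hdy, a, haL, hy, hab⟩ hdy
  have hb' : ∀ b z, D.dim z = j → D.pr z b → (T z ↔ T (D.tgt b)) := by
    intro b z hz h
    have := pr_dim h
    rcases h with h | h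
    · exact hb b (by omega) z h
    · rw [← D.precP_unique h]
  refine (conn_dim j T ?_ c (D.itTgt j) hc (dim_itTgt hj)).2 .refl
  intro b c c' hc h h'
  have := pr_dim h
  have := pr_dim h'
  rw [hb' b c hc h, hb' b c' (by omega) h']

theorem WW_of {j : ℕ} (hj : j ≤ D.dim D.top) (H : D.HH j) (W1 : D.WW (j + 1))
    (H1 : D.HH (j + 1)) : D.WW j := by
  intro c hc
  have hr := reach hj H W1 H1 c hc
  induction hr using ReflTransGen.head_induction_on with
  | refl =>
    intro h
    obtain ⟨c', ⟨b, hL, h1, -⟩, -⟩ := TransGen.head'_iff.1 h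
    exact H.P3 b hL h1
  | @head a c h _ ih =>
    intro h'
    have hd := nx_dim h
    obtain ⟨c', ⟨b', hL', h1', h2'⟩, h3⟩ := TransGen.head'_iff.1 h'
    refine ih (by omega) ?_
    obtain ⟨b, hL, h1, h2⟩ := id h
    have e := H.P2 a b b' hc hL hL' h1 h1'
    subst e
    have e' : c' = c := (D.precP_unique h2').trans (D.precP_unique h2).symm
    subst e'
    exact TransGen.tail' h3 h

/-- Number of middle faces is even. -/
theorem mid_even (z x : α) [DecidablePred (D.mid z x)] :
    Even (Finset.univ.filter (D.mid z x)).card := by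
  by_cases h : ∃ y, D.mid z x y
  · obtain ⟨y, hy⟩ := h
    obtain ⟨y', hne, hy', hu⟩ := mid_two hy
    have : Finset.univ.filter (D.mid z x) = Finset.cons y {y'} (by simpa using hne.symm) := by
      ext w
      simp only [Finset.mem_filter, Finset.mem_univ, true_and, Finset.mem_cons,
        Finset.mem_singleton]
      constructor
      · exact hu w
      · rintro (rfl | rfl) <;> assumption
    rw [this]
    simp
  · push Not at h
    have : Finset.univ.filter (D.mid z x) = ∅ := by
      ext w
      simp [h w]
    simp [this]

open Classical in
theorem parity (d a b : α) (S : α → Prop) (hb : D.precP b a)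
    (hS : ∀ y, D.precN y a → ∀ c c', D.mid d y c → D.mid d y c' → (S c ↔ S c')) :
    ∀ c c', D.mid d b c → D.mid d b c' → (S c ↔ S c') := by
  by_contra hcon
  push Not at hcon
  have hcon : ∃ c c', D.mid d b c ∧ D.mid d b c' ∧ S c ∧ ¬ S c' := by
    obtain ⟨c, c', h1, h2, h | h⟩ := hcon
    · exact ⟨c, c', h1, h2, h.1, h.2⟩
    · exact ⟨c', c, h2, h1, h.2, h.1⟩
  obtain ⟨c, c', hc, hc', hSc, hSc'⟩ := hcon
  have hcc : c ≠ c' := by rintro rfl; exact hSc' hSc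
  have key : ∑ y ∈ Finset.univ.filter (fun y => D.pr y a),
        (Finset.univ.filter (fun c => D.mid d y c ∧ S c)).card =
      ∑ c ∈ Finset.univ.filter (fun c => D.pr d c ∧ S c),
        (Finset.univ.filter (D.mid c a)).card := by
    simp only [Finset.card_filter, Finset.sum_filter]
    trans ∑ y, ∑ c, if (D.pr d c ∧ D.pr c y ∧ D.pr y a ∧ S c) then 1 else 0
    · refine Finset.sum_congr rfl fun y _ => ?_
      by_cases h : D.pr y a
      · simp only [h, if_true, mid, true_and, and_assoc]
      · simp [h]
    · rw [Finset.sum_comm]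
      refine Finset.sum_congr rfl fun c _ => ?_
      by_cases h : D.pr d c ∧ S c
      · simp only [h, mid, true_and, and_true, and_self, if_true]
        refine Finset.sum_congr rfl fun y _ => ?_
        congr
      · rw [if_neg h]
        refine Finset.sum_eq_zero fun y _ => if_neg ?_
        tauto
  have hR : Even (∑ c ∈ Finset.univ.filter (fun c => D.pr d c ∧ S c),
        (Finset.univ.filter (D.mid c a)).card) :=
    Finset.even_sum _ fun c _ => mid_even c a
  rw [← key, ← Finset.add_sum_erase _ _ (a := b) (Finset.mem_filter.2 ⟨Finset.mem_univ _, Or.inr hb⟩)] at hR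
  have h1 : (Finset.univ.filter (fun c => D.mid d b c ∧ S c)).card = 1 := by
    rw [Finset.card_eq_one]
    refine ⟨c, ?_⟩
    ext w
    simp only [Finset.mem_filter, Finset.mem_univ, true_and, Finset.mem_singleton]
    constructor
    · rintro ⟨hw, hw'⟩
      exact mid_third hc' hc hw hcc.symm (by rintro rfl; exact hSc' hw')
    · rintro rfl; exact ⟨hc, hSc⟩
  have h2 : Even (∑ y ∈ (Finset.univ.filter (fun y => D.pr y a)).erase b,
        (Finset.univ.filter (fun c => D.mid d y c ∧ S c)).card) := by
    refine Finset.even_sum _ fun y hy => ?_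
    simp only [Finset.mem_erase, Finset.mem_filter, Finset.mem_univ, true_and] at hy
    have hy' : D.precN y a := hy.2.resolve_right fun h =>
      hy.1 ((D.precP_unique h).trans (D.precP_unique hb).symm)
    by_cases he : ∃ c, D.mid d y c ∧ S c
    · obtain ⟨c, hc, hs⟩ := he
      have : Finset.univ.filter (fun c => D.mid d y c ∧ S c) = Finset.univ.filter (D.mid d y) := by
        ext w
        simp only [Finset.mem_filter, Finset.mem_univ, true_and, and_iff_left_iff_imp]
        intro hw
        exact (hS y hy' c w hc hw).1 hs
      rw [this]
      exact mid_even d y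
    · push Not at he
      have : Finset.univ.filter (fun c => D.mid d y c ∧ S c) = ∅ := by
        ext w
        simpa using he w
      simp [this]
  rw [h1] at hR
  have := (Nat.even_add.1 hR).2 h2
  simp at this

/-- closed under `Λ`-edges implies closed under all edges -/
theorem closed_all {k : ℕ} (H2 : D.HH (k + 2)) (W2 : D.WW (k + 2)) (d : α) (hd : D.dim d = k)
    (S : α → Prop)
    (hS : ∀ b, D.Lm b → ∀ c c', D.mid d b c → D.mid d b c' → (S c ↔ S c')) :
    ∀ b c c', D.mid d b c → D.mid d b c' → (S c ↔ S c') := by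
  intro b
  induction b using (wf_of_acyclic _ W2.acyclic).induction with
  | _ b ih =>
    by_cases hL : D.Lm b
    · exact hS b hL
    · intro c c' hc hc'
      have d1 := pr_dim hc.1
      have d2 := pr_dim hc.2
      unfold Lm at hL
      push Not at hL
      obtain ⟨a0, ha0⟩ := hL
      obtain ⟨a, haL, hab⟩ := H2.T2 b a0 (by omega) ha0
      refine parity d a b S hab (fun y hy => ih y ⟨?_, a, haL, hy, hab⟩) c c' hc hc'
      have := D.dim_precN hy
      have := D.dim_precP hab
      omega

/-- Local version of `nx` at cofaces of `d`. -/
def R (D : DFC α) (d c c' : α) : Prop := D.pr d c ∧ D.pr d c' ∧ D.nx c c'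

theorem R_sign {d c c' : α} (h : D.R d c c') : D.precN d c ↔ D.precN d c' := by
  obtain ⟨h1, h2, b, -, h3, h4⟩ := h
  exact sign_same ⟨h1, Or.inl h3⟩ ⟨h2, Or.inr h4⟩ h3 h4

theorem RR_sign {d c c' : α} (h : ReflTransGen (D.R d) c c') : D.precN d c ↔ D.precN d c' := by
  induction h with
  | refl => rfl
  | tail _ h ih => exact ih.trans (R_sign h)

theorem RR_pr {d c c' : α} (h : ReflTransGen (D.R d) c c') (hc : D.pr d c') : D.pr d c := by
  rcases ReflTransGen.cases_head h with rfl | ⟨x, h1, -⟩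
  · exact hc
  · exact h1.1

theorem all_under {k : ℕ} (H1 : D.HH (k + 1)) (H2 : D.HH (k + 2)) (W2 : D.WW (k + 2)) (d : α)
    (hd : D.dim d = k) (M : α → Prop) (m0 : α) (hm0 : M m0) (hm0d : D.pr d m0)
    (hM : ∀ m b c', M m → D.Lm b → D.precN m b → D.mid d b m → D.mid d b c' → M c') :
    ∀ c, D.pr d c → ∃ m, M m ∧ ReflTransGen (D.R d) c m := by
  intro c hc
  set A : α → Prop := fun c => ∃ m, M m ∧ ReflTransGen (D.R d) c m with hA
  refine (conn_coface d A (closed_all H2 W2 d hd A ?_) c m0 hc hm0d).2 ⟨m0, hm0, .refl⟩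
  have key : ∀ b, D.Lm b → ∀ c c', D.mid d b c → D.mid d b c' → A c → A c' := by
    rintro b hL c c' hc hc' ⟨m, hm, hcm⟩
    have d1 := pr_dim hc.1
    by_cases hne : c = c'
    · subst hne; exact ⟨m, hm, hcm⟩
    rcases hc.2 with h | h
    · rcases ReflTransGen.cases_head hcm with rfl | ⟨c1, ⟨h1, h2, b1, hL1, h3, h4⟩, h5⟩
      · exact ⟨c', hM c b c' hm hL h hc hc', .refl⟩
      · have e := H1.P2 c b b1 (by omega) hL hL1 h h3
        subst e
        have hc1 : D.mid d b c1 := ⟨h2, Or.inr h4⟩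
        have := mid_third hc hc1 hc' (precN_ne_tgt h h4) (Ne.symm hne)
        subst this
        exact ⟨m, hm, h5⟩
    · have h' : D.precN c' b := hc'.2.resolve_right fun h' =>
        hne ((D.precP_unique h).trans (D.precP_unique h').symm)
      exact ⟨m, hm, .head ⟨hc'.1, hc.1, b, hL, h', h⟩ hcm⟩
  exact fun b hL c c' hc hc' => ⟨key b hL c c' hc hc', key b hL c' c hc' hc⟩

theorem R_acyclic {k : ℕ} (W1 : D.WW (k + 1)) (d : α) (hd : D.dim d = k) (a : α) :
    ¬ TransGen (D.R d) a a := by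
  intro h
  refine W1.acyclic a (transGen_mono_aux (fun x y h => ⟨?_, h.2.2⟩) h)
  have := pr_dim h.1
  omega

theorem exists_min {k : ℕ} (H1 : D.HH (k + 1)) (W1 : D.WW (k + 1)) (d : α) (hd : D.dim d = k) :
    ∀ c, D.pr d c → ∃ l, D.Lm l ∧ D.pr d l ∧ ReflTransGen (D.R d) l c := by
  intro c
  induction c using (wf_of_acyclic _ (R_acyclic W1 d hd)).induction with
  | _ c ih =>
    intro hc
    have d1 := pr_dim hc
    by_cases hL : D.Lm c
    · exact ⟨c, hL, hc, .refl⟩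
    · unfold Lm at hL
      push Not at hL
      obtain ⟨b0, hb0⟩ := hL
      obtain ⟨b, hbL, hb⟩ := H1.T2 c b0 (by omega) hb0
      obtain ⟨c', hne, hm, -⟩ := mid_two (D := D) (z := d) (x := b) (y := c) ⟨hc, Or.inr hb⟩
      have h' : D.precN c' b := hm.2.resolve_right fun h' =>
        hne ((D.precP_unique h').trans (D.precP_unique hb).symm)
      have hR : D.R d c' c := ⟨hm.1, hc, b, hbL, h', hb⟩
      obtain ⟨l, h1, h2, h3⟩ := ih c' hR hm.1
      exact ⟨l, h1, h2, h3.tail hR⟩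

theorem exists_max {k : ℕ} (W1 : D.WW (k + 1)) (d : α) (hd : D.dim d = k) :
    ∀ c, D.pr d c → ∃ m, D.pr d m ∧ ∀ c', ¬ D.R d m c' := by
  intro c
  induction c using (wf_swap_of_acyclic _ (R_acyclic W1 d hd)).induction with
  | _ c ih =>
    intro hc
    by_cases h : ∃ c', D.R d c c'
    · obtain ⟨c', h⟩ := h
      exact ih c' h h.2.1
    · push Not at h
      exact ⟨c, hc, h⟩

theorem R_inj {k : ℕ} (H1 : D.HH (k + 1)) (d : α) (hd : D.dim d = k) {c1 c2 c : α}
    (h : D.R d c1 c) (h' : D.R d c2 c) : c1 = c2 := by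
  obtain ⟨h1, h2, b, hL, h3, h4⟩ := h
  obtain ⟨h1', -, b', hL', h3', h4'⟩ := h'
  have d1 := pr_dim h2
  have e := H1.T1 c b b' (by omega) hL hL' h4 h4'
  subst e
  exact mid_third (D := D) (z := d) (x := b) (y := c) ⟨h2, Or.inr h4⟩ ⟨h1', Or.inl h3'⟩
    ⟨h1, Or.inl h3⟩ (precN_ne_tgt h3' h4).symm (precN_ne_tgt h3 h4)

theorem min_unique {k : ℕ} (H1 : D.HH (k + 1)) (d : α) (hd : D.dim d = k) {l l' m : α}
    (hl : D.Lm l) (hl' : D.Lm l') (h : ReflTransGen (D.R d) l m)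
    (h' : ReflTransGen (D.R d) l' m) : l = l' := by
  have nop : ∀ {l x}, D.Lm l → ReflTransGen (D.R d) x l → x = l := by
    intro l x hl h
    rcases ReflTransGen.cases_tail h with h | ⟨y, -, -, -, b, -, -, hb⟩
    · exact h.symm
    · exact absurd hb (hl b)
  induction h with
  | refl => exact (nop hl h').symm
  | tail h0 h1 ih =>
    rcases ReflTransGen.cases_tail h' with h2 | ⟨y, h2, h3⟩
    · subst h2
      exact nop hl' (h0.tail h1)
    · have := R_inj H1 d hd h1 h3
      subst this
      exact ih h2

theorem main_dichotomy {k : ℕ} (hk : k + 1 ≤ D.dim D.top) (H1 : D.HH (k + 1)) (W1 : D.WW (k + 1))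
    (H2 : D.HH (k + 2)) (W2 : D.WW (k + 2)) (d : α) (hd : D.dim d = k) :
    (D.pr d (D.itTgt (k + 1)) ∧
      ∀ c, D.pr d c → ReflTransGen (D.R d) c (D.itTgt (k + 1))) ∨
    (¬ D.pr d (D.itTgt (k + 1)) ∧ ∃ m m', D.precN d m ∧ D.precP d m' ∧
      ∀ c, D.pr d c → ReflTransGen (D.R d) c m ∨ ReflTransGen (D.R d) c m') := by
  obtain ⟨c0, hc0, -⟩ := fle_coface (fle_tp (D := D) d) (by omega)
  obtain ⟨m, hm, hmax⟩ := exists_max W1 d hd c0 hc0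
  have dm := pr_dim hm
  by_cases hg : m = D.itTgt (k + 1)
  · left
    subst hg
    refine ⟨hm, fun c hc => ?_⟩
    obtain ⟨m, rfl, h⟩ := all_under H1 H2 W2 d hd (fun m => m = D.itTgt (k + 1)) _ rfl hm
      (by rintro _ b c' rfl hL h; exact absurd h (H1.P3 b hL)) c hc
    exact h
  · right
    obtain ⟨b, hL, hmb⟩ := H1.P1 m (by omega) hg
    have hmid : D.mid d b m := ⟨hm, Or.inl hmb⟩
    obtain ⟨m', hne, hmid', hu⟩ := mid_two hmid
    have hm'b : D.precN m' b := hmid'.2.resolve_right fun h =>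
      hmax m' ⟨hm, hmid'.1, b, hL, hmb, h⟩
    have dm' := pr_dim hmid'.1
    have hall : ∀ c, D.pr d c → ReflTransGen (D.R d) c m ∨ ReflTransGen (D.R d) c m' := by
      intro c hc
      obtain ⟨x, rfl | rfl, h⟩ := all_under H1 H2 W2 d hd (fun x => x = m ∨ x = m') m (Or.inl rfl) hm
        (by
          rintro x b' c' hx hL' h - hc'
          have e : b' = b := by
            rcases hx with rfl | rfl
            · exact H1.P2 x b' b (by omega) hL' hL h hmb
            · exact H1.P2 x b' b (by omega) hL' hL h hm'b
          subst e
          exact hu c' hc') c hc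
      · exact Or.inl h
      · exact Or.inr h
    refine ⟨fun hgd => ?_, ?_⟩
    · have hng : ∀ x, x ≠ D.itTgt (k + 1) → ¬ ReflTransGen (D.R d) (D.itTgt (k + 1)) x := by
        intro x hx h
        rcases ReflTransGen.cases_head h with h | ⟨y, ⟨-, -, b, hL, h, -⟩, -⟩
        · exact hx h.symm
        · exact H1.P3 b hL h
      rcases hall _ hgd with h | h
      · exact hng m hg h
      · refine hng m' ?_ h
        rintro rfl
        exact H1.P3 b hL hm'b
    · have sd := sign_diff hmid hmid' hmb hm'b hne.symm
      have sd' := sign_diff hmid' hmid hm'b hmb hne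
      rcases hm with h | h
      · exact ⟨m, m', h, sd.1 h, hall⟩
      · exact ⟨m', m, sd'.2 h, h, fun c hc => (hall c hc).symm⟩

theorem HH_step {k : ℕ} (hk : k + 1 ≤ D.dim D.top) (H1 : D.HH (k + 1)) (W1 : D.WW (k + 1))
    (H2 : D.HH (k + 2)) (W2 : D.WW (k + 2)) : D.HH k := by
  have nb : ∀ {y x : α}, D.precN y x → D.precP y x → False := fun h h' => D.not_both _ _ ⟨h, h'⟩
  have uniq : ∀ d b b', D.dim d = k → D.Lm b → D.Lm b' → D.pr d b → D.pr d b' →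
      (D.precN d b ↔ D.precN d b') → b = b' := by
    intro d b b' hd hL hL' h h' hs
    rcases main_dichotomy hk H1 W1 H2 W2 d hd with ⟨-, hall⟩ | ⟨-, m, m', hm, hm', hall⟩
    · exact min_unique H1 d hd hL hL' (hall b h) (hall b' h')
    · have no : ∀ {x x'}, (D.precN d x ↔ D.precN d x') → ReflTransGen (D.R d) x m →
          ReflTransGen (D.R d) x' m' → False := fun hs h1 h2 =>
        nb ((RR_sign h2).1 (hs.1 ((RR_sign h1).2 hm))) hm'
      rcases hall b h with h1 | h1 <;> rcases hall b' h' with h2 | h2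
      · exact min_unique H1 d hd hL hL' h1 h2
      · exact (no hs h1 h2).elim
      · exact (no hs.symm h2 h1).elim
      · exact min_unique H1 d hd hL hL' h1 h2
  have hgt := itTgt_succ hk
  have hgd := dim_itTgt hk
  refine ⟨?_, ?_, ?_, ?_, ?_⟩
  · intro d hd hne
    have : ∃ m, D.precN d m := by
      rcases main_dichotomy hk H1 W1 H2 W2 d hd with ⟨hg, -⟩ | ⟨-, m, -, hm, -⟩
      · refine ⟨_, hg.resolve_right fun h => hne ?_⟩
        rw [D.precP_unique h, D.precP_unique hgt]
      · exact ⟨m, hm⟩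
    obtain ⟨m, hm⟩ := this
    obtain ⟨l, h1, h2, h3⟩ := exists_min H1 W1 d hd m (Or.inl hm)
    exact ⟨l, h1, (RR_sign h3).2 hm⟩
  · intro d b b' hd hL hL' h h'
    exact uniq d b b' hd hL hL' (Or.inl h) (Or.inl h') (iff_of_true h h')
  · intro b hL hb
    have dg : D.dim (D.itTgt k) = k := dim_itTgt (by omega)
    rcases main_dichotomy hk H1 W1 H2 W2 _ dg with ⟨-, hall⟩ | ⟨hn, -⟩
    · exact nb ((RR_sign (hall b (Or.inl hb))).1 hb) hgt
    · exact hn (Or.inr hgt)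
  · intro d b b' hd hL hL' h h'
    exact uniq d b b' hd hL hL' (Or.inr h) (Or.inr h')
      (iff_of_false (fun h0 => nb h0 h) (fun h0 => nb h0 h'))
  · intro d c hd hc
    obtain ⟨l, h1, h2, h3⟩ := exists_min H1 W1 d hd c (Or.inr hc)
    exact ⟨l, h1, h2.resolve_left fun h => nb ((RR_sign h3).1 h) hc⟩

theorem HH_triv {j : ℕ} (hj : D.dim D.top ≤ j) : D.HH j ∧ D.WW j := by
  have le : ∀ x, D.dim x ≤ D.dim D.top := fun x => fle_dim (fle_tp x)
  have no : ∀ {d b}, D.dim d = j → ¬ D.pr d b := fun {d b} hd h => by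
    have := pr_dim h; have := le b; omega
  refine ⟨⟨?_, ?_, ?_, ?_, ?_⟩, ?_⟩
  · intro d hd hne
    refine absurd (fle_eq (fle_tp (D := D) d) (by omega)) ?_
    have e : D.dim D.top - j = 0 := by omega
    simpa [itTgt, e] using hne
  · exact fun d b b' hd _ _ h => absurd (Or.inl h) (no hd)
  · intro b _ h
    have e : D.dim D.top - j = 0 := by omega
    simp only [itTgt, e, Function.iterate_zero, id] at h
    have := D.dim_precN h
    have := le b
    omega
  · exact fun d b b' hd _ _ h => absurd (Or.inr h) (no hd)
  · exact fun d b hd h => absurd (Or.inr h) (no hd)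
  · intro c hc h
    obtain ⟨_, ⟨b, _, h, _⟩, _⟩ := TransGen.head'_iff.1 h
    exact no hc (Or.inl h)

theorem HH_all (i : ℕ) : ∀ j, j + i = D.dim D.top →
    (D.HH j ∧ D.WW j) ∧ (D.HH (j + 1) ∧ D.WW (j + 1)) := by
  induction i with
  | zero => intro j hj; exact ⟨HH_triv (by omega), HH_triv (by omega)⟩
  | succ i ih =>
    intro j hj
    obtain ⟨⟨H1, W1⟩, ⟨H2, W2⟩⟩ := ih (j + 1) (by omega)
    have H := HH_step (by omega) H1 W1 H2 W2
    exact ⟨⟨H, WW_of (by omega) H W1 H1⟩, H1, W1⟩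

end DFC

/-- sources partition: for `0 ≤ k ≤ n − 1`,
`C_k \ {γ^{(k)}ω} = ∐_{c ∈ Λ_{k+1}} δ(c)`: every `d ∈ C_k` other than `γ^{(k)}ω`
is a source of exactly one `c ∈ Λ_{k+1}`, and `γ^{(k)}ω` is a source of none. -/
theorem dfc_sources_partition {α : Type*} [Fintype α] (D : DFC α) (k : ℕ)
    (hk : k + 1 ≤ D.dim D.top) :
    (∀ d, D.dim d = k → d ≠ D.itTgt k → ∃! c, D.lam (k + 1) c ∧ D.precN d c) ∧
    (∀ c, D.lam (k + 1) c → ¬ D.precN (D.itTgt k) c) := by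
  obtain ⟨⟨H, -⟩, -⟩ := D.HH_all (D.dim D.top - k) k (by omega)
  refine ⟨fun d hd hne => ?_, fun c hc => H.P3 c hc.2⟩
  obtain ⟨b, hL, hb⟩ := H.P1 d hd hne
  refine ⟨b, ⟨⟨by rw [D.dim_precN hb, hd], hL⟩, hb⟩, ?_⟩
  rintro c ⟨⟨-, hc⟩, hdc⟩
  exact H.P2 d c b hd hc hL hdc hb
end

section
/- Let C be a dendritic face complex and let e, e' ∈ C_k and d ∈ C_{k+1} with e ≺⁻ d and e' ≺⁺ d. Then there exist q ≥ 1, faces d₁, …, d_q ∈ Λ_{k+1}, and faces e = e₀, e₁, …, e_q = e' such that e_{i−1} ≺⁻ d_i and e_i ≺⁺ d_i for all 1 ≤ i ≤ q (an upper path from e to e' all of whose witnessing faces lie in Λ_{k+1}). -/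
namespace DFC

variable {α : Type*} [Fintype α]

theorem aux_t1 (D : DFC α) {x y z : α} (h : D.precN z y) (h' : D.precP y x) :
    ∃ y', D.precN z y' ∧ D.precN y' x := by
  obtain ⟨y', ⟨hne, a', b', hb, ha, hs⟩, -⟩ := D.thin true false x y z h h'
  cases a' <;> cases b' <;> simp_all [sprec]
  · exact ⟨y', hb, ha⟩
  · exact absurd ((D.precP_unique ha).trans (D.precP_unique h').symm) hne

theorem aux_t2 (D : DFC α) {x y z : α} (h : D.precP z y) (h' : D.precN y x) :
    (∃ y', D.precN z y' ∧ D.precN y' x) ∨ (∃ y', D.precP z y' ∧ D.precP y' x) := by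
  obtain ⟨y', ⟨hne, a', b', hb, ha, hs⟩, -⟩ := D.thin false true x y z h h'
  cases a' <;> cases b' <;> simp_all [sprec]
  · exact Or.inl ⟨y', hb, ha⟩
  · exact Or.inr ⟨y', hb, ha⟩

theorem aux_t3 (D : DFC α) {x y z : α} (h : D.precN z y) (h' : D.precN y x) :
    (∃ y', D.precP z y' ∧ D.precN y' x) ∨ (∃ y', D.precN z y' ∧ D.precP y' x) := by
  obtain ⟨y', ⟨hne, a', b', hb, ha, hs⟩, -⟩ := D.thin false false x y z h h'
  cases a' <;> cases b' <;> simp_all [sprec]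
  · exact Or.inl ⟨y', hb, ha⟩
  · exact Or.inr ⟨y', hb, ha⟩

theorem aux_seq {r : α → α → Prop} {a b : α} (h : Relation.TransGen r a b) :
    ∃ p : ℕ, 1 ≤ p ∧ ∃ f : ℕ → α, f 0 = a ∧ f p = b ∧ ∀ i, i < p → r (f i) (f (i + 1)) := by
  induction h with
  | @single b h =>
    refine ⟨1, le_rfl, fun i => if i = 0 then a else b, by simp, by simp, ?_⟩
    intro i hi
    have : i = 0 := by omega
    subst this
    simpa using h
  | @tail b c _ h ih =>
    obtain ⟨p, hp, f, h0, h1, h2⟩ := ih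
    refine ⟨p + 1, by omega, fun i => if i ≤ p then f i else c, by simp [h0], by simp, ?_⟩
    intro i hi
    by_cases hip : i < p
    · have e1 : i ≤ p := by omega
      have e2 : i + 1 ≤ p := hip
      simp only [e1, e2, if_true]
      exact h2 i hip
    · have : i = p := by omega
      subst this
      simpa [h1] using h

/-- Lower flow inside the sources of `x`, reversed. -/
def auxT (D : DFC α) (x a b : α) : Prop := D.precN a x ∧ D.precN b x ∧ D.precN (D.tgt b) a

theorem auxT_irrefl (D : DFC α) (x y : α) : ¬ Relation.TransGen (D.auxT x) y y := by
  intro h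
  obtain ⟨p, hp, f, h0, h1, h2⟩ := aux_seq h
  refine D.no_cycle x p hp (fun i => f (i - 1)) ?_ ?_ ?_
  · intro i hi hip
    exact (h2 (i - 1) (by omega)).1
  · simp [h0, h1]
  · intro i hi hip
    have := (h2 (i - 1) (by omega)).2.2
    rw [Nat.sub_add_cancel hi] at this
    simpa using this

theorem aux_wf {r : α → α → Prop} (h : ∀ x, ¬ Relation.TransGen r x x) : WellFounded r := by
  have : Std.Irrefl (Relation.TransGen r) := ⟨h⟩
  have : IsTrans α (Relation.TransGen r) := ⟨fun _ _ _ => Relation.TransGen.trans⟩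
  have := Finite.wellFounded_of_trans_of_irrefl (Relation.TransGen r)
  exact Subrelation.wf (fun h => Relation.TransGen.single h) this

theorem aux_wf_flip {r : α → α → Prop} (h : ∀ x, ¬ Relation.TransGen r x x) :
    WellFounded (Function.swap r) := by
  apply aux_wf
  intro x hx
  exact h x (Relation.transGen_swap.1 hx)

/-- `tri` restricted to dimension `m`. -/
def auxR (D : DFC α) (m : ℕ) (a b : α) : Prop := D.dim a = m ∧ D.tri a b

def auxAcy (D : DFC α) (m : ℕ) : Prop := ∀ x, ¬ Relation.TransGen (D.auxR m) x x

/-- Elementary step with witness satisfying `p`. -/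
def auxM (D : DFC α) (p : α → Prop) (a b : α) : Prop := ∃ y, p y ∧ D.precN a y ∧ D.precP b y

theorem aux_local (D : DFC α) {c d e e' : α} (h1 : D.precN e d) (h2 : D.precP e' d)
    (hc : D.precP d c) : Relation.TransGen (D.auxM (fun y => D.precN y c)) e e' := by
  have key : ∀ y, D.precN y c → ∀ a, D.precN a y →
      Relation.TransGen (D.auxM (fun y => D.precN y c)) a e' := by
    intro y
    induction y using (aux_wf (D.auxT_irrefl c)).induction with
    | _ y ih =>
      intro hy a ha
      have hty : D.precP (D.tgt y) y := D.tgt_precP y (by have := D.dim_precN ha; omega)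
      rcases D.aux_t2 hty hy with ⟨y', g1, g2⟩ | ⟨y', g1, g2⟩
      · exact Relation.TransGen.head ⟨y, hy, ha, hty⟩ (ih y' ⟨g2, hy, g1⟩ g2 _ g1)
      · have : y' = d := (D.precP_unique g2).trans (D.precP_unique hc).symm
        subst this
        have : D.tgt y = e' := (D.precP_unique g1).trans (D.precP_unique h2).symm
        rw [this] at hty
        exact Relation.TransGen.single ⟨y, hy, ha, hty⟩
  obtain ⟨y, g1, g2⟩ := D.aux_t1 h1 hc
  exact key y g2 e g1

theorem aux_replace (D : DFC α) (m : ℕ) (hA : D.auxAcy m) :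
    ∀ d e e', D.dim d = m → D.precN e d → D.precP e' d →
      Relation.TransGen (D.auxM (D.lam m)) e e' := by
  intro d
  induction d using (aux_wf hA).induction with
  | _ d ih =>
    intro e e' hd h1 h2
    by_cases hl : ∀ c, ¬ D.precP d c
    · exact Relation.TransGen.single ⟨d, ⟨hd, hl⟩, h1, h2⟩
    · push Not at hl
      obtain ⟨c, hc⟩ := hl
      have := D.aux_local h1 h2 hc
      refine Relation.TransGen.closed ?_ _ _ this
      rintro a b ⟨y, hy, ha, hb⟩
      have hdy : D.dim y = m := by
        have := D.dim_precN hy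
        have := D.dim_precP hc
        omega
      exact ih y ⟨hdy, c, hy, hc⟩ a b hdy ha hb

theorem aux_up (D : DFC α) (x : α) (hx : x ≠ D.top) : ∃ y, D.precN x y ∨ D.precP x y := by
  rcases Relation.ReflTransGen.cases_head (D.le_top x) with h | ⟨y, h, -⟩
  · exact absurd h hx
  · exact ⟨y, h⟩

theorem aux_dim_le (D : DFC α) (x : α) : D.dim x ≤ D.dim D.top := by
  induction D.le_top x using Relation.ReflTransGen.head_induction_on with
  | refl => exact le_rfl
  | head h _ ih =>
    rcases h with h | h
    · have := D.dim_precN h; omega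
    · have := D.dim_precP h; omega

theorem aux_top (D : DFC α) (x : α) (hx : D.dim x = D.dim D.top) : x = D.top := by
  by_contra h
  obtain ⟨y, hy⟩ := D.aux_up x h
  have := D.aux_dim_le y
  rcases hy with h | h
  · have := D.dim_precN h; omega
  · have := D.dim_precP h; omega

/-- Uniqueness of the non-source in dimension `m`. -/
def auxU (D : DFC α) (m : ℕ) : Prop := ∀ x y, D.dim x = m → D.dim y = m →
  (∀ c, ¬ D.precN x c) → (∀ c, ¬ D.precN y c) → x = y

theorem aux_nonsource_up (D : DFC α) (m : ℕ) (hA : D.auxAcy (m + 1)) (x : α) (hx : D.dim x = m)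
    (hm : m < D.dim D.top) (hn : ∀ c, ¬ D.precN x c) :
    ∃ c, D.precP x c ∧ ∀ b, ¬ D.precN c b := by
  obtain ⟨c0, hc0⟩ := D.aux_up x (by rintro rfl; omega)
  have hc0 : D.precP x c0 := hc0.resolve_left (hn c0)
  obtain ⟨c, hc, hmax⟩ := (aux_wf_flip hA).has_min {c | D.precP x c} ⟨c0, hc0⟩
  refine ⟨c, hc, fun b hb => ?_⟩
  rcases D.aux_t2 hc hb with ⟨y', g1, g2⟩ | ⟨y', g1, g2⟩
  · exact hn _ g1
  · exact hmax y' g1 ⟨by have := D.dim_precP hc; omega, b, hb, g2⟩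

theorem aux_U_step (D : DFC α) (m : ℕ) (hA : D.auxAcy (m + 1)) (hU : D.auxU (m + 1))
    (hm : m < D.dim D.top) : D.auxU m := by
  intro x y hx hy hnx hny
  obtain ⟨c, hc, hc'⟩ := D.aux_nonsource_up m hA x hx hm hnx
  obtain ⟨b, hb, hb'⟩ := D.aux_nonsource_up m hA y hy hm hny
  have := hU c b (by have := D.dim_precP hc; omega) (by have := D.dim_precP hb; omega) hc' hb'
  subst this
  exact (D.precP_unique hc).trans (D.precP_unique hb).symm

theorem aux_lam_up (D : DFC α) (m : ℕ) (hA : D.auxAcy (m + 1)) (x : α) (hx : D.lam m x)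
    (hm : m < D.dim D.top) :
    ∃ c, D.precN x c ∧ ∀ b, ¬ D.precN c b := by
  obtain ⟨hx, hl⟩ := hx
  obtain ⟨c0, hc0⟩ := D.aux_up x (by rintro rfl; omega)
  have hc0 : D.precN x c0 := hc0.resolve_right (hl c0)
  obtain ⟨c, hc, hmax⟩ := (aux_wf_flip hA).has_min {c | D.precN x c} ⟨c0, hc0⟩
  refine ⟨c, hc, fun b hb => ?_⟩
  rcases D.aux_t3 hc hb with ⟨y', g1, g2⟩ | ⟨y', g1, g2⟩
  · exact hl _ g1
  · exact hmax y' g1 ⟨by have := D.dim_precN hc; omega, b, hb, g2⟩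

theorem aux_no_cycle (D : DFC α) (u e : α) :
    ¬ Relation.TransGen (D.auxM (fun y => D.precN y u)) e e := by
  intro h
  have key : ∀ b, Relation.TransGen (D.auxM (fun y => D.precN y u)) e b →
      ∃ d d', D.precN e d ∧ D.precP b d' ∧ D.precN d u ∧ D.precN d' u ∧
        Relation.ReflTransGen (D.auxT u) d' d := by
    intro b hb
    induction hb with
    | single h =>
      obtain ⟨y, hy, h1, h2⟩ := h
      exact ⟨y, y, h1, h2, hy, hy, Relation.ReflTransGen.refl⟩
    | tail _ h ih =>
      obtain ⟨y, hy, h1, h2⟩ := h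
      obtain ⟨d, d', g1, g2, g3, g4, g5⟩ := ih
      refine ⟨d, y, g1, h2, g3, hy, Relation.ReflTransGen.head ⟨hy, g4, ?_⟩ g5⟩
      rw [← D.precP_unique g2]
      exact h1
  obtain ⟨d, d', g1, g2, g3, g4, g5⟩ := key e h
  refine D.auxT_irrefl u d (Relation.TransGen.head' ⟨g3, g4, ?_⟩ g5)
  rw [← D.precP_unique g2]
  exact g1

theorem aux_top_no_cycle (D : DFC α) (t e : α) :
    ¬ Relation.TransGen (D.auxM (fun y => y = t)) e e := by
  intro h
  have key : ∀ b, Relation.TransGen (D.auxM (fun y => y = t)) e b →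
      D.precN e t ∧ D.precP b t := by
    intro b hb
    induction hb with
    | single h =>
      obtain ⟨y, rfl, h1, h2⟩ := h
      exact ⟨h1, h2⟩
    | tail _ h ih =>
      obtain ⟨y, rfl, h1, h2⟩ := h
      exact ⟨ih.1, h2⟩
  exact D.not_both _ _ (key e h)

theorem aux_main (D : DFC α) (j : ℕ) : ∀ m, D.dim D.top ≤ m + j →
    D.auxAcy m ∧ D.auxU m := by
  induction j with
  | zero =>
    intro m hm
    constructor
    · have hno : ∀ a b, ¬ D.auxR m a b := by
        rintro a b ⟨h, t, h1, -⟩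
        have := D.dim_precN h1
        have := D.aux_dim_le t
        omega
      intro x hx
      obtain ⟨_, h, -⟩ := Relation.TransGen.head'_iff.1 hx
      exact hno _ _ h
    · intro x y hx hy _ _
      have h1 := D.aux_dim_le x
      have h2 := D.aux_dim_le y
      rw [D.aux_top x (by omega), D.aux_top y (by omega)]
  | succ j ih =>
    intro m hm
    by_cases hlt : D.dim D.top ≤ m + j
    · exact ih m hlt
    obtain ⟨hA, hU⟩ := ih (m + 1) (by omega)
    refine ⟨?_, D.aux_U_step m hA hU (by omega)⟩
    intro x hx
    have hL : Relation.TransGen (D.auxM (D.lam (m + 1))) x x := by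
      refine Relation.TransGen.closed ?_ _ _ hx
      rintro a b ⟨ha, t, h1, h2⟩
      exact D.aux_replace (m + 1) hA t a b (by have := D.dim_precN h1; omega) h1 h2
    by_cases hj : D.dim D.top = m + 1
    · refine D.aux_top_no_cycle D.top x (Relation.TransGen.mono ?_ _ _ hL)
      rintro a b ⟨y, hy, h⟩
      exact ⟨y, D.aux_top y (by rw [hy.1, hj]), h⟩
    · obtain ⟨hA', hU'⟩ := ih (m + 1 + 1) (by omega)
      have hup := fun y hy => D.aux_lam_up (m + 1) hA' y hy (by omega)
      obtain ⟨_, ⟨y0, hy0, -⟩, -⟩ := Relation.TransGen.head'_iff.1 hL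
      obtain ⟨u, hu, hu'⟩ := hup y0 hy0
      refine D.aux_no_cycle u x (Relation.TransGen.mono ?_ _ _ hL)
      rintro a b ⟨y, hy, h⟩
      obtain ⟨v, hv, hv'⟩ := hup y hy
      have : v = u := hU' v u (by rw [D.dim_precN hv, hy.1]) (by rw [D.dim_precN hu, hy0.1]) hv' hu'
      subst this
      exact ⟨y, hv, h⟩

end DFC

/-- if `e ≺⁻ d` and `e' ≺⁺ d` with `e, e' ∈ C_k`, `d ∈ C_{k+1}`, then
there is an upper path `e = e₀ ≺⁻ d₁ ≻⁺ e₁ ≺⁻ d₂ ≻⁺ ⋯ ≻⁺ e_q = e'` (`q ≥ 1`) all of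
whose witnessing faces `dᵢ` lie in `Λ_{k+1}`. -/
theorem dfc_path_in_lam {α : Type*} [Fintype α] (D : DFC α) (k : ℕ) (e e' d : α)
    (he : D.dim e = k) (he' : D.dim e' = k) (hd : D.dim d = k + 1)
    (h1 : D.precN e d) (h2 : D.precP e' d) :
    ∃ q : ℕ, 1 ≤ q ∧ ∃ ds es : ℕ → α, es 0 = e ∧ es q = e' ∧
      ∀ i, 1 ≤ i → i ≤ q →
        D.lam (k + 1) (ds i) ∧ D.precN (es (i - 1)) (ds i) ∧ D.precP (es i) (ds i) := by
  have hA := (D.aux_main (D.dim D.top) (k + 1) (by omega)).1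
  obtain ⟨q, hq, es, h0, hq', hs⟩ := DFC.aux_seq (D.aux_replace (k + 1) hA d e e' hd h1 h2)
  have hs' : ∀ i, ∃ y, 1 ≤ i → i ≤ q →
      D.lam (k + 1) y ∧ D.precN (es (i - 1)) y ∧ D.precP (es i) y := by
    intro i
    by_cases hi : 1 ≤ i ∧ i ≤ q
    · obtain ⟨y, hy⟩ := hs (i - 1) (by omega)
      rw [Nat.sub_add_cancel hi.1] at hy
      exact ⟨y, fun _ _ => hy⟩
    · exact ⟨e, fun a b => absurd ⟨a, b⟩ hi⟩
  choose ds hds using hs'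
  exact ⟨q, hq, ds, es, h0, hq', hds⟩
end

section
/- Let C be a dendritic face complex and let d, d' ∈ C_k with k ≥ 1 and d <⁺ d'. Then γ(d) = γ(d') or γ(d) <⁺ γ(d') (taking targets is monotone along upper paths). -/
namespace DFC

/-- One step: inside `δ(t)`, either the target of `d` is the target of `γ(t)`, or it is a source
of another element of `δ(t)`. -/
theorem aux_step {α : Type*} [Fintype α] (D : DFC α) (t d : α) (hd : 1 ≤ D.dim d)
    (h : D.precN d t) :
    D.tgt d = D.tgt (D.tgt t) ∨ ∃ y, D.precN y t ∧ D.precN (D.tgt d) y := by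
  obtain ⟨y, ⟨-, a, b, h1, h2, h3⟩, -⟩ :=
    D.thin false true t d (D.tgt d) (D.tgt_precP d hd) h
  cases a <;> cases b <;> simp [sprec] at h1 h2 h3
  · exact Or.inr ⟨y, h2, h1⟩
  · left
    rw [← D.precP_unique h2]
    exact D.precP_unique h1

theorem aux_tri {α : Type*} [Fintype α] (D : DFC α) (t d : α) (hd : 1 ≤ D.dim d)
    (h : D.precN d t) :
    D.tgt d = D.tgt (D.tgt t) ∨ D.ltP (D.tgt d) (D.tgt (D.tgt t)) := by
  by_contra hc
  let S := {y : α // D.precN y t ∧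
    ¬ (D.tgt y = D.tgt (D.tgt t) ∨ D.ltP (D.tgt y) (D.tgt (D.tgt t)))}
  have step : ∀ y : S, ∃ y' : S, D.precN (D.tgt y.1) y'.1 := by
    rintro ⟨y, hy, hny⟩
    have hdt := D.dim_precN h
    have hdy := D.dim_precN hy
    rcases D.aux_step t y (by omega) hy with h1 | ⟨y', h1, h2⟩
    · exact absurd (Or.inl h1) hny
    · refine ⟨⟨y', h1, fun hcl => hny (Or.inr ?_)⟩, h2⟩
      have hdy' := D.dim_precN h1
      have htri : D.tri (D.tgt y) (D.tgt y') := ⟨y', h2, D.tgt_precP y' (by omega)⟩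
      rcases hcl with e | e
      · exact e ▸ Relation.TransGen.single htri
      · exact Relation.TransGen.head htri e
  choose f hf using step
  let s : ℕ → S := fun n => f^[n] ⟨d, h, hc⟩
  have hs : ∀ n, D.precN (D.tgt (s n).1) (s (n + 1)).1 := by
    intro n
    have : s (n + 1) = f (s n) := Function.iterate_succ_apply' f n _
    rw [this]
    exact hf _
  have key : ∀ i j, i < j → s i = s j → False := by
    intro i j hij e
    refine D.no_cycle t (j - i) (by omega) (fun m => (s (j + 1 - m)).1)
      (fun m _ _ => (s _).2.1) ?_ ?_
    · have h1 : j + 1 - (j - i + 1) = i := by omega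
      have h2 : j + 1 - 1 = j := by omega
      simp only [h1, h2, e]
    · intro m hm1 hm2
      have h1 : j + 1 - m = (j + 1 - (m + 1)) + 1 := by omega
      show D.precN (D.tgt (s (j + 1 - (m + 1))).1) (s (j + 1 - m)).1
      rw [h1]
      exact hs _
  obtain ⟨i, j, hne, e⟩ := Finite.exists_ne_map_eq_of_infinite s
  rcases lt_or_gt_of_ne hne with hl | hl
  · exact key i j hl e
  · exact key j i hl e.symm

end DFC

/-- taking targets is monotone along upper paths: for `d, d' ∈ C_k`
with `k ≥ 1` and `d <⁺ d'`, one has `γ(d) = γ(d')` or `γ(d) <⁺ γ(d')`. -/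
theorem dfc_tgt_monotone {α : Type*} [Fintype α] (D : DFC α) (k : ℕ) (hk : 1 ≤ k)
    (d d' : α) (hd : D.dim d = k) (hd' : D.dim d' = k) (h : D.ltP d d') :
    D.tgt d = D.tgt d' ∨ D.ltP (D.tgt d) (D.tgt d') := by
  have htri : ∀ a b, D.dim a = k → D.tri a b →
      D.dim b = k ∧ (D.tgt a = D.tgt b ∨ D.ltP (D.tgt a) (D.tgt b)) := by
    rintro a b ha ⟨t, h1, h2⟩
    have e1 := D.dim_precN h1
    have e2 := D.dim_precP h2
    refine ⟨by omega, ?_⟩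
    rw [D.precP_unique h2]
    exact D.aux_tri t a (by omega) h1
  clear hd'
  have main : D.dim d' = k ∧ (D.tgt d = D.tgt d' ∨ D.ltP (D.tgt d) (D.tgt d')) := by
    unfold DFC.ltP at h
    induction h with
    | single h => exact htri _ _ hd h
    | tail _ h2 ih =>
      obtain ⟨hb, hc⟩ := htri _ _ ih.1 h2
      refine ⟨hb, ?_⟩
      rcases ih.2 with e | e
      · rw [e]; exact hc
      · rcases hc with e' | e'
        · exact Or.inr (e' ▸ e)
        · exact Or.inr (Relation.TransGen.trans e e')
  exact main.2
end
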